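/- For every prime p, the elementary abelian group E_9 of order 9, the cyclic group C_p of order p, and the cyclic group C_{3p} of order 3p are separable with respect to the class 𝒦_A of all finite abelian groups. -/

import Mathlib

open scoped Pointwise

/-- The number of representations of `z` as `x * y` with `x ∈ X`, `y ∈ Y`
(used for the structure constants of an S-ring). -/
def structConst {G : Type*} [Group G] [DecidableEq G] (X Y : Finset G) (z : G) : ℕ :=
  ((X ×ˢ Y).filter (fun q => q.1 * q.2 = z)).card

/-- An S-ring (Schur ring) over a finite group `G`, given by its partition into basic sets:
the partition contains `{1}`, is closed under inversion, and the products of the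
characteristic sums of two blocks are integral linear combinations of characteristic sums,
i.e. the number of representations `z = x * y` (`x ∈ X`, `y ∈ Y`) is constant for `z`
ranging over a block `Z`. -/
structure SRing (G : Type*) [Group G] [Fintype G] [DecidableEq G] where
  basicSets : Finset (Finset G)
  nonempty_mem : ∀ X ∈ basicSets, X.Nonempty
  exists_mem : ∀ g : G, ∃ X ∈ basicSets, g ∈ X
  disj : ∀ X ∈ basicSets, ∀ Y ∈ basicSets, X ≠ Y → Disjoint X Y
  one_mem : ({1} : Finset G) ∈ basicSets
  inv_mem : ∀ X ∈ basicSets, X.image (fun x => x⁻¹) ∈ basicSets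
  structConst_eq : ∀ X ∈ basicSets, ∀ Y ∈ basicSets, ∀ Z ∈ basicSets,
    ∀ z ∈ Z, ∀ z' ∈ Z, structConst X Y z = structConst X Y z'

namespace SRing

variable {G G' : Type*} [Group G] [Fintype G] [DecidableEq G]
  [Group G'] [Fintype G'] [DecidableEq G']

/-- An algebraic isomorphism between S-rings: a bijection between the sets of basic sets
preserving the structure constants. -/
def IsAlgIso (A : SRing G) (B : SRing G') (φ : Finset G → Finset G') : Prop :=
  Set.BijOn φ (A.basicSets : Set (Finset G)) (B.basicSets : Set (Finset G')) ∧
  ∀ X ∈ A.basicSets, ∀ Y ∈ A.basicSets, ∀ Z ∈ A.basicSets,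
    ∀ z ∈ Z, ∀ z' ∈ φ Z, structConst X Y z = structConst (φ X) (φ Y) z'

/-- `φ` is induced by the bijection `f : G → G'` if `R(X)^f = R(X^φ)` for every basic set `X`,
where `R(X) = {(g, xg) : x ∈ X, g ∈ G}`; equivalently (for bijective `f`),
`h * g⁻¹ ∈ X ↔ f h * (f g)⁻¹ ∈ φ X` for all `g h`. -/
def Induces (A : SRing G) (B : SRing G') (φ : Finset G → Finset G') (f : G → G') : Prop :=
  Function.Bijective f ∧
  ∀ X ∈ A.basicSets, ∀ g h : G, h * g⁻¹ ∈ X ↔ f h * (f g)⁻¹ ∈ φ X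

/-- Separability with respect to the class of all finite abelian groups. -/
def SeparableA (A : SRing G) : Prop :=
  ∀ (H : Type) [CommGroup H] [Fintype H] [DecidableEq H],
    ∀ (B : SRing H) (φ : Finset G → Finset H),
      A.IsAlgIso B φ → ∃ f : G → H, A.Induces B φ f

/-- `X` is an `A`-set: a union of basic sets of `A`. -/
def IsASet (A : SRing G) (X : Finset G) : Prop :=
  ∀ Y ∈ A.basicSets, (Y ∩ X).Nonempty → Y ⊆ X

end SRing

/-- Two colourings of finite abelian groups describing S-rings together with an algebraic
isomorphism between them: a basic set and its image carry the same colour. Equality of the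
structure constants is expressed by bijections matching the decompositions of `v` and `w`. -/
structure AlgMatch {V W κ : Type*} [AddCommGroup V] [AddCommGroup W] (c : V → κ) (c' : W → κ) :
    Prop where
  zero : c' 0 = c 0
  eq_zero : ∀ v, c v = c 0 → v = 0
  eq_zero' : ∀ w, c' w = c' 0 → w = 0
  neg : ∀ v w, c v = c' w → c (-v) = c' (-w)
  exists_equiv : ∀ v w, c v = c' w →
    ∃ e : V ≃ W, ∀ x, c' (e x) = c x ∧ c' (w - e x) = c (v - x)

/-- The colourings are matched by a bijection preserving the colours of all differences. -/
def Realizable {V W κ : Type*} [AddCommGroup V] [AddCommGroup W] (c : V → κ) (c' : W → κ) :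
    Prop :=
  ∃ f : V → W, ∀ g h, c' (f h - f g) = c (h - g)

namespace AlgMatch

variable {V W Z κ : Type*} [AddCommGroup V] [AddCommGroup W] [AddCommGroup Z]
  {c : V → κ} {c' : W → κ} {c'' : Z → κ}

theorem symm (M : AlgMatch c c') : AlgMatch c' c where
  zero := M.zero.symm
  eq_zero := M.eq_zero'
  eq_zero' := M.eq_zero
  neg v w h := (M.neg w v h.symm).symm
  exists_equiv v w h := by
    obtain ⟨e, he⟩ := M.exists_equiv w v h.symm
    refine ⟨e.symm, fun x => ?_⟩
    have := he (e.symm x)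
    simp only [Equiv.apply_symm_apply] at this
    exact ⟨this.1.symm, this.2.symm⟩

theorem exists_color (M : AlgMatch c c') (v : V) : ∃ w, c' w = c v := by
  obtain ⟨e, he⟩ := M.exists_equiv 0 0 M.zero.symm
  exact ⟨e v, (he v).1⟩

theorem trans (M : AlgMatch c c') (N : AlgMatch c' c'') : AlgMatch c c'' where
  zero := N.zero.trans M.zero
  eq_zero := M.eq_zero
  eq_zero' := N.eq_zero'
  neg v z h := by
    obtain ⟨w, hw⟩ := M.exists_color v
    exact (M.neg v w hw.symm).trans (N.neg w z (hw.trans h))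
  exists_equiv v z h := by
    obtain ⟨w, hw⟩ := M.exists_color v
    obtain ⟨e, he⟩ := M.exists_equiv v w hw.symm
    obtain ⟨e', he'⟩ := N.exists_equiv w z (hw.trans h)
    exact ⟨e.trans e', fun x =>
      ⟨(he' (e x)).1.trans (he x).1, (he' (e x)).2.trans (he x).2⟩⟩

theorem self (M : AlgMatch c c') : AlgMatch c c := M.trans M.symm

theorem equiv (M : AlgMatch c c') : Nonempty (V ≃ W) := by
  obtain ⟨e, -⟩ := M.exists_equiv 0 0 M.zero.symm
  exact ⟨e⟩

theorem comp_left (M : AlgMatch c c') (a : Z ≃+ V) : AlgMatch (c ∘ a) c' where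
  zero := by simpa using M.zero
  eq_zero v h := by simpa using M.eq_zero (a v) (by simpa using h)
  eq_zero' := M.eq_zero'
  neg v w h := by simpa using M.neg (a v) w h
  exists_equiv v w h := by
    obtain ⟨e, he⟩ := M.exists_equiv (a v) w h
    refine ⟨a.toEquiv.trans e, fun x => ?_⟩
    simpa using he (a x)

theorem comp_right (M : AlgMatch c c') (b : Z ≃+ W) : AlgMatch c (c' ∘ b) :=
  (M.symm.comp_left b).symm

/-- Colour-preserving homomorphisms from a common group realize the matching. -/
theorem realizable_of_hom {I : Type*} [AddCommGroup I] (r : I →+ V) (r' : I →+ W)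
    (hr : Function.Surjective r) (h : ∀ i, c' (r' i) = c (r i)) : Realizable c c' := by
  refine ⟨fun v => r' (Function.surjInv hr v), fun g k => ?_⟩
  rw [← map_sub, h, map_sub, Function.surjInv_eq hr, Function.surjInv_eq hr]

theorem _root_.Realizable.of_comp {Z' : Type*} [AddCommGroup Z'] (a : Z ≃+ V) (b : Z' ≃+ W)
    (h : Realizable (c ∘ a) (c' ∘ b)) : Realizable c c' := by
  obtain ⟨f, hf⟩ := h
  refine ⟨fun v => b (f (a.symm v)), fun g k => ?_⟩
  simpa using hf (a.symm g) (a.symm k)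

end AlgMatch

theorem exists_equiv_of_card_fiber_eq {X Y K : Type*} [Fintype X] [Fintype Y] [DecidableEq K]
    (F : X → K) (F' : Y → K)
    (h : ∀ k, (Finset.univ.filter (fun x => F x = k)).card =
      (Finset.univ.filter (fun y => F' y = k)).card) :
    ∃ e : X ≃ Y, ∀ x, F' (e x) = F x := by
  have e (k : K) : {x // F x = k} ≃ {y // F' y = k} :=
    Fintype.equivOfCardEq (by rw [Fintype.card_subtype, Fintype.card_subtype, h k])
  refine ⟨Equiv.ofFiberEquiv e, fun x => ?_⟩
  exact Equiv.ofFiberEquiv_map e x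

namespace SRing

variable {G H : Type*} [CommGroup G] [Fintype G] [DecidableEq G]
  [CommGroup H] [Fintype H] [DecidableEq H]

/-- The basic set containing `g`. -/
noncomputable def basicSetOf (A : SRing G) (g : G) : Finset G := (A.exists_mem g).choose

theorem basicSetOf_mem (A : SRing G) (g : G) : A.basicSetOf g ∈ A.basicSets :=
  (A.exists_mem g).choose_spec.1

theorem mem_basicSetOf (A : SRing G) (g : G) : g ∈ A.basicSetOf g :=
  (A.exists_mem g).choose_spec.2

theorem basicSetOf_eq_iff (A : SRing G) {X : Finset G} (hX : X ∈ A.basicSets) (g : G) :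
    A.basicSetOf g = X ↔ g ∈ X := by
  constructor
  · rintro rfl
    exact A.mem_basicSetOf g
  · intro h
    by_contra hne
    exact Finset.disjoint_left.1 (A.disj _ (A.basicSetOf_mem g) X hX hne) (A.mem_basicSetOf g) h

theorem basicSetOf_inv (A : SRing G) {g h : G} (hgh : A.basicSetOf g = A.basicSetOf h) :
    A.basicSetOf g⁻¹ = A.basicSetOf h⁻¹ := by
  have h1 := A.inv_mem _ (A.basicSetOf_mem g)
  rw [(A.basicSetOf_eq_iff h1 _).2, eq_comm, (A.basicSetOf_eq_iff h1 _).2]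
  · exact Finset.mem_image_of_mem _ (hgh ▸ A.mem_basicSetOf h)
  · exact Finset.mem_image_of_mem _ (A.mem_basicSetOf g)

theorem structConst_eq_card (X Y : Finset G) (z : G) :
    structConst X Y z = (Finset.univ.filter (fun x : G => x ∈ X ∧ z / x ∈ Y)).card := by
  refine Finset.card_bij (fun q _ => q.1) ?_ ?_ ?_
  · rintro ⟨x, y⟩ h
    simp only [Finset.mem_filter, Finset.mem_product, Finset.mem_univ, true_and] at h ⊢
    obtain ⟨⟨hx, hy⟩, rfl⟩ := h
    simpa [hx] using hy
  · rintro ⟨x, y⟩ h ⟨x', y'⟩ h' rfl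
    simp only [Finset.mem_filter] at h h'
    have := h.2.trans h'.2.symm
    simpa using this
  · intro x hx
    simp only [Finset.mem_filter, Finset.mem_univ, true_and] at hx
    exact ⟨(x, z / x), by simp [hx], rfl⟩

theorem IsAlgIso.map_one {A : SRing G} {B : SRing H} {φ : Finset G → Finset H}
    (hφ : A.IsAlgIso B φ) : φ {1} = {1} := by
  obtain ⟨Y, hY, hY1⟩ := hφ.1.surjOn B.one_mem
  obtain ⟨y, hy⟩ := A.nonempty_mem Y hY
  have h := hφ.2 _ A.one_mem Y hY Y hY y hy 1 (by simp [hY1])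
  have h1 : structConst {1} Y y ≠ 0 := by
    rw [structConst_eq_card, Finset.card_ne_zero]
    exact ⟨1, by simpa using hy⟩
  rw [h, hY1, structConst_eq_card, Finset.card_ne_zero] at h1
  obtain ⟨x, hx⟩ := h1
  simp only [Finset.mem_filter, Finset.mem_univ, true_and, Finset.mem_singleton,
    div_eq_one] at hx
  rw [← (B.basicSetOf_eq_iff (hφ.1.mapsTo A.one_mem) x).2 hx.1,
    (B.basicSetOf_eq_iff B.one_mem x).2 (by simp [← hx.2])]

theorem IsAlgIso.algMatch {A : SRing G} {B : SRing H} {φ : Finset G → Finset H}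
    (hφ : A.IsAlgIso B φ) :
    AlgMatch (fun v : Additive G => φ (A.basicSetOf v.toMul))
      (fun w : Additive H => B.basicSetOf w.toMul) := by
  have key : ∀ v w, φ (A.basicSetOf v) = B.basicSetOf w → ∃ e : G ≃ H, ∀ x,
      B.basicSetOf (e x) = φ (A.basicSetOf x) ∧
        B.basicSetOf (w / e x) = φ (A.basicSetOf (v / x)) := by
    intro v w hvw
    suffices hcard : ∀ i j,
        (Finset.univ.filter fun x : G =>
          φ (A.basicSetOf x) = i ∧ φ (A.basicSetOf (v / x)) = j).card =
        (Finset.univ.filter fun y : H => B.basicSetOf y = i ∧ B.basicSetOf (w / y) = j).card by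
      obtain ⟨e, he⟩ := exists_equiv_of_card_fiber_eq
        (fun x => (φ (A.basicSetOf x), φ (A.basicSetOf (v / x))))
        (fun y => (B.basicSetOf y, B.basicSetOf (w / y)))
        (fun k => by simpa only [Prod.ext_iff] using hcard k.1 k.2)
      exact ⟨e, fun x => by simpa using he x⟩
    intro i j
    by_cases hi : i ∈ B.basicSets
    swap
    · have h1 : ∀ x, φ (A.basicSetOf x) ≠ i := fun x h =>
        hi (h ▸ hφ.1.mapsTo (A.basicSetOf_mem x))
      have h2 : ∀ y, B.basicSetOf y ≠ i := fun y h => hi (h ▸ B.basicSetOf_mem y)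
      simp [h1, h2]
    by_cases hj : j ∈ B.basicSets
    swap
    · have h1 : ∀ x, φ (A.basicSetOf x) ≠ j := fun x h =>
        hj (h ▸ hφ.1.mapsTo (A.basicSetOf_mem x))
      have h2 : ∀ y, B.basicSetOf y ≠ j := fun y h => hj (h ▸ B.basicSetOf_mem y)
      simp [h1, h2]
    obtain ⟨X, hX, rfl⟩ := hφ.1.surjOn hi
    obtain ⟨Y, hY, rfl⟩ := hφ.1.surjOn hj
    have h := hφ.2 X hX Y hY _ (A.basicSetOf_mem v) v (A.mem_basicSetOf v) w
      (hvw ▸ B.mem_basicSetOf w)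
    rw [structConst_eq_card, structConst_eq_card] at h
    have hinj : ∀ (X : Finset G) (_ : X ∈ A.basicSets) (g : G),
        φ (A.basicSetOf g) = φ X ↔ g ∈ X := fun X hX g => by
      rw [hφ.1.injOn.eq_iff (A.basicSetOf_mem g) hX, A.basicSetOf_eq_iff hX]
    simpa only [hinj _ hX, hinj _ hY, B.basicSetOf_eq_iff hi, B.basicSetOf_eq_iff hj] using h
  have h1 : A.basicSetOf 1 = {1} := (A.basicSetOf_eq_iff A.one_mem 1).2 (by simp)
  have h1' : B.basicSetOf 1 = {1} := (B.basicSetOf_eq_iff B.one_mem 1).2 (by simp)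
  have hzero : φ (A.basicSetOf 1) = B.basicSetOf 1 := by rw [h1, h1', hφ.map_one]
  refine ⟨hzero.symm, ?_, ?_, ?_, ?_⟩
  · intro v hv
    have := hφ.1.injOn (A.basicSetOf_mem _) (A.basicSetOf_mem _) hv
    rw [toMul_zero, h1, A.basicSetOf_eq_iff A.one_mem] at this
    exact Finset.mem_singleton.1 this
  · intro w hw
    rw [toMul_zero, h1', B.basicSetOf_eq_iff B.one_mem] at hw
    exact Finset.mem_singleton.1 hw
  · intro v w hvw
    obtain ⟨e, he⟩ := key 1 1 hzero
    have h2 := he v.toMul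
    simp only [one_div] at h2
    rw [toMul_neg, toMul_neg, ← h2.2]
    exact B.basicSetOf_inv (h2.1.trans hvw)
  · exact fun v w h => key v.toMul w.toMul h

theorem separableA_of_realizable (A : SRing G)
    (h : ∀ (H : Type) [CommGroup H] [Fintype H] (c : Additive G → Finset H)
      (c' : Additive H → Finset H), AlgMatch c c' → Realizable c c') : A.SeparableA := by
  intro H _ _ _ B φ hφ
  have M := hφ.algMatch
  obtain ⟨f, hf⟩ := h H _ _ M
  refine ⟨fun g => (f (.ofMul g)).toMul, ?_, ?_⟩
  · have hinj : Function.Injective f := fun g k hgk => by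
      have := hf k g
      rw [hgk, sub_self] at this
      exact sub_eq_zero.1 (M.eq_zero _ (this.symm.trans M.zero))
    obtain ⟨e⟩ := M.equiv
    have := (Fintype.bijective_iff_injective_and_card f).2 ⟨hinj, Fintype.card_congr e⟩
    exact this
  · intro X hX g k
    have := hf (.ofMul g) (.ofMul k)
    rw [← div_eq_mul_inv, ← div_eq_mul_inv,
      ← B.basicSetOf_eq_iff (hφ.1.mapsTo hX), ← A.basicSetOf_eq_iff hX,
      ← hφ.1.injOn.eq_iff (A.basicSetOf_mem _) hX]
    exact (Eq.congr_left this).symm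

end SRing

/-- The colour class of `x` is contained in `{x, -x}`. -/
def IsPM {V κ : Type*} [AddCommGroup V] (c : V → κ) (x : V) : Prop :=
  ∀ y, c y = c x → y = x ∨ y = -x

namespace AlgMatch

variable {V W κ : Type*} [AddCommGroup V] [AddCommGroup W] {c : V → κ} {c' : W → κ}

theorem exists_add (M : AlgMatch c c') {x y : V} {w : W} (h : c' w = c (x + y)) :
    ∃ a b, w = a + b ∧ c' a = c x ∧ c' b = c y := by
  obtain ⟨e, he⟩ := M.exists_equiv (x + y) w h.symm
  have := he x
  refine ⟨e x, w - e x, by abel, this.1, ?_⟩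
  rw [this.2, add_sub_cancel_left]

theorem color_neg (M : AlgMatch c c') {v : V} {w : W} (h : c' w = c v) : c' (-w) = c (-v) :=
  (M.neg v w h.symm).symm

theorem eq_zero_iff (M : AlgMatch c c') {v : V} {w : W} (h : c' w = c v) : w = 0 ↔ v = 0 := by
  constructor
  · rintro rfl
    exact M.eq_zero v (h.symm.trans M.zero)
  · rintro rfl
    exact M.eq_zero' w (h.trans M.zero.symm)

theorem isPM (M : AlgMatch c c') (h2 : ∀ w : W, w + w = 0 → w = 0) {x : V} {y : W}
    (hx : IsPM c x) (hy : c' y = c x) : IsPM c' y := by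
  intro z hz
  by_cases hy0 : y = 0
  · left
    rw [hy0] at hz ⊢
    exact M.eq_zero' z hz
  obtain ⟨e, he⟩ := M.exists_equiv 0 0 M.zero.symm
  have key : ∀ u, c' u = c x → e.symm u = x ∨ e.symm u = -x := fun u hu =>
    hx _ (by rw [← (he _).1, Equiv.apply_symm_apply, hu])
  have hyy : y ≠ -y := fun h => hy0 (h2 y (by nth_rw 2 [h]; simp))
  have hzx := hz.trans hy
  by_contra! hne
  have hny : c' (-y) = c x := by
    have h1 := M.color_neg hy
    rcases key y hy with h | h <;> rcases key z hzx with h' | h'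
    · exact absurd (e.symm.injective (h'.trans h.symm)) hne.1
    · rw [h1, ← h', ← (he _).1, Equiv.apply_symm_apply, hzx]
    · rw [h1, ← h, ← (he _).1, Equiv.apply_symm_apply, hy]
    · exact absurd (e.symm.injective (h'.trans h.symm)) hne.1
  rcases key y hy with h | h <;> rcases key z hzx with h' | h' <;>
    rcases key (-y) hny with h'' | h'' <;>
    first
    | exact absurd (e.symm.injective (h'.trans h.symm)) hne.1
    | exact absurd (e.symm.injective (h'.trans h''.symm)) hne.2
    | exact absurd (e.symm.injective (h.trans h''.symm)) hyy

theorem three_smul (M : AlgMatch c c') (h2 : ∀ w : W, w + w = 0 → w = 0) {x : V} {y : W}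
    (hx : IsPM c x) (hx3 : 3 • x = 0) (hy : c' y = c x) : 3 • y = 0 := by
  have h : c' (-y) = c (x + x) := by
    rw [M.color_neg hy]
    congr 1
    linear_combination (norm := module) -hx3
  obtain ⟨a, b, hab, ha, hb⟩ := M.exists_add h
  have hp := M.isPM h2 hx hy
  rcases hp a (ha.trans hy.symm) with rfl | rfl <;> rcases hp b (hb.trans hy.symm) with rfl | rfl
  · linear_combination (norm := module) -hab
  · rw [h2 a (by linear_combination (norm := module) (-2 : ℤ) • hab)]; simp
  · rw [h2 b (by linear_combination (norm := module) (-2 : ℤ) • hab)]; simp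
  · rw [h2 y (by linear_combination (norm := module) 2 • hab)]; simp

theorem singleton_add (M : AlgMatch c c') {u v : V} {u' v' : W} (hu : ∀ b, c' b = c u → b = u')
    (hv : ∀ b, c' b = c v → b = v') (b : W) (h : c' b = c (u + v)) : b = u' + v' := by
  obtain ⟨s, t, rfl, hs, ht⟩ := M.exists_add h
  rw [hu s hs, hv t ht]

theorem pair_double (M : AlgMatch c c') (h2 : ∀ v : V, v + v = 0 → v = 0) {u : V} {u' : W}
    (hu : ∀ b, c' b = c u → b = u' ∨ b = -u') (hs : c (-u) = c u) (hu' : c' u' = c u)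
    (hu0 : u ≠ 0) :
    (∀ b, c' b = c (2 • u) → b = 2 • u' ∨ b = -(2 • u')) ∧ c (-(2 • u)) = c (2 • u) ∧
      c' (2 • u') = c (2 • u) := by
  have h20 : 2 • u ≠ 0 := fun h => hu0 (h2 u (by rwa [two_nsmul] at h))
  have key : ∀ w, c' w = c u → ∃ a, (w = a + u' ∨ w = a - u') ∧ c' a = c (2 • u) := by
    intro w hw
    have h : c' w = c (2 • u + -u) := by
      rw [hw]
      congr 1
      module
    obtain ⟨a, b, rfl, ha, hb⟩ := M.exists_add h
    refine ⟨a, ?_, ha⟩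
    rcases hu b (hb.trans hs) with rfl | rfl
    · exact .inl rfl
    · exact .inr (by abel)
  have h3 : c' (2 • u') = c (2 • u) := by
    obtain ⟨a, h | h, ha⟩ := key u' hu'
    · have : a = 0 := by simpa using h
      exact absurd ((M.eq_zero_iff ha).1 this) h20
    · rwa [show 2 • u' = a by linear_combination (norm := module) h]
  have h4 : c' (-(2 • u')) = c (2 • u) := by
    obtain ⟨a, h | h, ha⟩ := key (-u') (by rw [M.color_neg hu', hs])
    · rwa [show -(2 • u') = a by linear_combination (norm := module) h]
    · have : a = 0 := by linear_combination (norm := module) -h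
      exact absurd ((M.eq_zero_iff ha).1 this) h20
  refine ⟨fun b hb => ?_, by rw [← M.color_neg h3, h4], h3⟩
  obtain ⟨s, t, rfl, hs', ht⟩ := M.exists_add (hb.trans (by rw [two_nsmul]))
  have h0 : s + t ≠ 0 := fun h => h20 ((M.eq_zero_iff hb).1 h)
  rcases hu s hs' with rfl | rfl <;> rcases hu t ht with rfl | rfl
  · exact .inl (by module)
  · simp at h0
  · simp at h0
  · exact .inr (by module)

theorem realizable_of_isPM_of_three_smul_ne (M : AlgMatch c c') (hV : Nat.card V = 9)
    (h9 : ∀ v : V, 9 • v = 0) (h9' : ∀ w : W, 9 • w = 0)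
    {x : V} (hx : IsPM c x) (hx3 : 3 • x ≠ 0) : Realizable c c' := by
  have h2 : ∀ v : V, v + v = 0 → v = 0 := fun v hv => by
    linear_combination (norm := module) h9 v - 4 • hv
  have h2' : ∀ v : W, v + v = 0 → v = 0 := fun v hv => by
    linear_combination (norm := module) h9' v - 4 • hv
  obtain ⟨y, hy⟩ := M.exists_color x
  have hp := M.isPM h2' hx hy
  have hy3 : 3 • y ≠ 0 := fun h => hx3 (M.symm.three_smul h2 hp h hy.symm)
  have hx0 : x ≠ 0 := by
    rintro rfl
    simp at hx3
  have hsurj : Function.Surjective (zmultiplesHom V x) := by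
    have : Finite V := Nat.finite_of_card_ne_zero (by omega)
    have hord : addOrderOf x = 3 ^ (1 + 1) :=
      addOrderOf_eq_prime_pow (by simpa using hx3) (by simpa using h9 x)
    have htop : AddSubgroup.zmultiples x = ⊤ :=
      AddSubgroup.eq_top_of_card_eq _ (by rw [Nat.card_zmultiples, hord, hV]; rfl)
    intro v
    obtain ⟨k, hk⟩ := AddSubgroup.mem_zmultiples_iff.1 (htop ▸ AddSubgroup.mem_top v)
    exact ⟨k, by simpa using hk⟩
  refine realizable_of_hom (zmultiplesHom V x) (zmultiplesHom W y) hsurj ?_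
  simp only [zmultiplesHom_apply]
  by_cases hs : c (-x) = c x
  swap
  · have h1 : ∀ b, c' b = c x → b = y := fun b hb => by
      rcases hp b (hb.trans hy.symm) with rfl | rfl
      · rfl
      · exact absurd ((M.color_neg hy).symm.trans hb) hs
    have h4 : ∀ n : ℕ, ∀ b, c' b = c (n • x) → b = n • y := by
      intro n
      induction n with
      | zero =>
        intro b hb
        rw [zero_smul] at hb ⊢
        exact (M.eq_zero_iff hb).2 rfl
      | succ n ih =>
        rw [succ_nsmul, succ_nsmul]
        exact M.singleton_add ih h1
    intro k
    obtain ⟨q, n, rfl⟩ : ∃ q : ℤ, ∃ n : ℕ, k = 9 * q + n :=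
      ⟨k / 9, (k % 9).toNat, by omega⟩
    rw [show (9 * q + n : ℤ) • x = n • x by linear_combination (norm := module) q • h9 x,
      show (9 * q + n : ℤ) • y = n • y by linear_combination (norm := module) q • h9' y]
    obtain ⟨b, hb⟩ := M.exists_color (n • x)
    rwa [← h4 n b hb]
  · have p1 : ∀ b, c' b = c x → b = y ∨ b = -y := fun b hb => hp b (hb.trans hy.symm)
    have h20 : 2 • x ≠ 0 := fun h => hx0 (h2 x (by rwa [two_nsmul] at h))
    obtain ⟨p2, s2, e2⟩ := M.pair_double h2 p1 hs hy hx0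
    obtain ⟨-, -, e4⟩ := M.pair_double h2 p2 s2 e2 h20
    have p3 : ∀ b, c' b = c (3 • x) → b = 3 • y ∨ b = -(3 • y) := by
      intro b hb
      have hne : c (3 • x) ≠ c x := fun h => by
        rcases hx _ h with h | h
        · exact h20 (by linear_combination (norm := module) h)
        · exact hx0 (by linear_combination (norm := module) h9 x - 2 • h)
      obtain ⟨s, t, rfl, hs', ht⟩ := M.exists_add (x := 2 • x) (y := x)
        (hb.trans (by congr 1; module))
      rcases p2 s hs' with rfl | rfl <;> rcases p1 t ht with rfl | rfl
      · exact .inl (by module)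
      · refine absurd (hb.symm.trans ?_) hne
        rw [← hy]
        congr 1
        module
      · refine absurd (hb.symm.trans ?_) hne
        rw [← hs, ← M.color_neg hy]
        congr 1
        module
      · exact .inr (by module)
    have e3 : c' (3 • y) = c (3 • x) := by
      obtain ⟨s, t, hst, hs', ht⟩ := M.exists_add (w := y) (x := 3 • x) (y := -(2 • x))
        (hy.trans (by congr 1; module))
      rcases p3 s hs' with rfl | rfl
      · exact hs'
      · exfalso
        rcases p2 t (ht.trans s2) with rfl | rfl
        · exact hy3 (by linear_combination (norm := module) (-3 : ℤ) • hst + h9' y)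
        · exact hy3 (by linear_combination (norm := module) (-1 : ℤ) • hst + h9' y)
    intro k
    have hred : ∀ s t : ℤ, k = 9 * t + s → c' (s • y) = c (s • x) →
        c' (k • y) = c (k • x) := by
      rintro s t rfl h
      rwa [show (9 * t + s) • x = s • x by linear_combination (norm := module) t • h9 x,
        show (9 * t + s) • y = s • y by linear_combination (norm := module) t • h9' y]
    have hneg : ∀ s : ℤ, c' (s • y) = c (s • x) → c' ((-s) • y) = c ((-s) • x) := by
      intro s h
      rw [neg_smul, neg_smul, M.color_neg h]
    have q0 : c' ((0 : ℤ) • y) = c ((0 : ℤ) • x) := by simpa using M.zero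
    have q1 : c' ((1 : ℤ) • y) = c ((1 : ℤ) • x) := by simpa using hy
    have q2 : c' ((2 : ℤ) • y) = c ((2 : ℤ) • x) := by exact_mod_cast e2
    have q3 : c' ((3 : ℤ) • y) = c ((3 : ℤ) • x) := by exact_mod_cast e3
    have q4 : c' ((4 : ℤ) • y) = c ((4 : ℤ) • x) := by
      rw [smul_smul, smul_smul] at e4
      exact_mod_cast e4
    have hk : k % 9 = 0 ∨ k % 9 = 1 ∨ k % 9 = 2 ∨ k % 9 = 3 ∨ k % 9 = 4 ∨
      k % 9 = 5 ∨ k % 9 = 6 ∨ k % 9 = 7 ∨ k % 9 = 8 := by omega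
    rcases hk with h | h | h | h | h | h | h | h | h
    · exact hred 0 (k / 9) (by omega) q0
    · exact hred 1 (k / 9) (by omega) q1
    · exact hred 2 (k / 9) (by omega) q2
    · exact hred 3 (k / 9) (by omega) q3
    · exact hred 4 (k / 9) (by omega) q4
    · exact hred (-4) (k / 9 + 1) (by omega) (hneg 4 q4)
    · exact hred (-3) (k / 9 + 1) (by omega) (hneg 3 q3)
    · exact hred (-2) (k / 9 + 1) (by omega) (hneg 2 q2)
    · exact hred (-1) (k / 9 + 1) (by omega) (hneg 1 q1)

theorem _root_.eq_zero_or_eq_or_eq_neg_of_card_three {Q : Type*} [AddCommGroup Q]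
    (hQ : Nat.card Q = 3) {q : Q} (hq : q ≠ 0) (t : Q) : t = 0 ∨ t = q ∨ t = -q := by
  classical
  have : Finite Q := Nat.finite_of_card_ne_zero (by omega)
  have := Fintype.ofFinite Q
  have h3 : 3 • q = 0 := hQ ▸ card_nsmul_eq_zero'
  have hqq : q ≠ -q := fun h => hq (by linear_combination (norm := module) h3 - h)
  have hu : ({0, q, -q} : Finset Q) = Finset.univ := by
    rw [← Finset.card_eq_iff_eq_univ, ← Nat.card_eq_fintype_card, hQ, Finset.card_eq_three]
    exact ⟨0, q, -q, hq.symm, by simpa [eq_comm] using hq, hqq, rfl⟩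
  have ht := Finset.mem_univ t
  rw [← hu] at ht
  simpa using ht

theorem _root_.exists_eq_zsmul_add_zsmul (hV : Nat.card V = 9) {u x : V} (hu3 : 3 • u = 0)
    (hu0 : u ≠ 0) (hx0 : x ≠ 0) (hxu : x ≠ u) (hxu' : x ≠ -u) (v : V) :
    ∃ i j : ℤ, (i = 0 ∨ i = 1 ∨ i = -1) ∧ (j = 0 ∨ j = 1 ∨ j = -1) ∧ v = i • x + j • u := by
  have hfin : Finite V := Nat.finite_of_card_ne_zero (by omega)
  set U := AddSubgroup.zmultiples u with hU
  have hcU : Nat.card U = 3 := by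
    rw [hU, Nat.card_zmultiples]
    simpa using addOrderOf_eq_prime_pow (p := 3) (n := 0) (x := u) (by simpa using hu0)
      (by simpa using hu3)
  have hcQ : Nat.card (V ⧸ U) = 3 := by
    have := U.card_mul_index
    rw [hcU, hV, AddSubgroup.index] at this
    omega
  have hmem : ∀ t ∈ U, ∃ j : ℤ, (j = 0 ∨ j = 1 ∨ j = -1) ∧ t = j • u := by
    intro t ht
    have := eq_zero_or_eq_or_eq_neg_of_card_three hcU (q := ⟨u, AddSubgroup.mem_zmultiples u⟩)
      (by simpa using hu0) ⟨t, ht⟩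
    simp only [Subtype.ext_iff, AddSubgroup.coe_neg, AddSubgroup.coe_zero] at this
    rcases this with h | h | h
    · exact ⟨0, by simp, by simp [h]⟩
    · exact ⟨1, by simp, by simp [h]⟩
    · exact ⟨-1, by simp, by simp [h]⟩
  have hxU : (x : V ⧸ U) ≠ 0 := by
    rw [Ne, QuotientAddGroup.eq_zero_iff]
    intro h
    obtain ⟨j, hj, rfl⟩ := hmem x h
    rcases hj with rfl | rfl | rfl <;> simp_all
  have key : ∀ i : ℤ, (v : V ⧸ U) = ((i • x : V) : V ⧸ U) →
      ∃ j : ℤ, (j = 0 ∨ j = 1 ∨ j = -1) ∧ v = i • x + j • u := by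
    intro i hi
    obtain ⟨j, hj, h⟩ := hmem _ (QuotientAddGroup.eq.1 hi.symm)
    exact ⟨j, hj, by rw [← h]; abel⟩
  rcases eq_zero_or_eq_or_eq_neg_of_card_three hcQ hxU v with h | h | h
  · obtain ⟨j, hj⟩ := key 0 (by simpa using h)
    exact ⟨0, j, by simp, hj⟩
  · obtain ⟨j, hj⟩ := key 1 (by simpa using h)
    exact ⟨1, j, by simp, hj⟩
  · obtain ⟨j, hj⟩ := key (-1) (by simpa using h)
    exact ⟨-1, j, by simp, hj⟩

theorem realizable_of_basis (M : AlgMatch c c') (hV : Nat.card V = 9) {x u : V} {y u' : W}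
    (hx3 : 3 • x = 0) (hu3 : 3 • u = 0) (hy3 : 3 • y = 0) (hu3' : 3 • u' = 0)
    (hu0 : u ≠ 0) (hx0 : x ≠ 0) (hxu : x ≠ u) (hxu' : x ≠ -u)
    (hy : c' y = c x) (hu : c' u' = c u) (hadd : c' (y + u') = c (x + u))
    (hsub : c' (y - u') = c (x - u)) : Realizable c c' := by
  refine realizable_of_hom ((zmultiplesHom V x).coprod (zmultiplesHom V u))
    ((zmultiplesHom W y).coprod (zmultiplesHom W u')) ?_ ?_
  · intro v
    obtain ⟨i, j, -, -, rfl⟩ := exists_eq_zsmul_add_zsmul hV hu3 hu0 hx0 hxu hxu' v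
    exact ⟨(i, j), by simp⟩
  · rintro ⟨a, b⟩
    have hk : ∀ k : ℤ, ∃ q i : ℤ, k = 3 * q + i ∧ (i = 0 ∨ i = 1 ∨ i = -1) := by
      intro k
      have h : k % 3 = 0 ∨ k % 3 = 1 ∨ k % 3 = 2 := by omega
      rcases h with h | h | h
      · exact ⟨k / 3, 0, by omega, by simp⟩
      · exact ⟨k / 3, 1, by omega, by simp⟩
      · exact ⟨k / 3 + 1, -1, by omega, by simp⟩
    obtain ⟨q, i, rfl, hi⟩ := hk a
    obtain ⟨q', j, rfl, hj⟩ := hk b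
    simp only [AddMonoidHom.coprod_apply, zmultiplesHom_apply]
    rw [show (3 * q + i) • x + (3 * q' + j) • u = i • x + j • u by
        linear_combination (norm := module) q • hx3 + q' • hu3,
      show (3 * q + i) • y + (3 * q' + j) • u' = i • y + j • u' by
        linear_combination (norm := module) q • hy3 + q' • hu3']
    have h1 := M.color_neg hadd
    have h2 := M.color_neg hsub
    rw [neg_add, neg_add] at h1
    rw [neg_sub, neg_sub, sub_eq_neg_add, sub_eq_neg_add u] at h2
    rw [sub_eq_add_neg, sub_eq_add_neg] at hsub
    rcases hi with rfl | rfl | rfl <;> rcases hj with rfl | rfl | rfl <;>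
      simp [M.zero, hy, hu, hadd, hsub, M.color_neg hy, M.color_neg hu, h1, h2]

theorem singleton_translate (M : AlgMatch c c') {x : V} {y : W}
    (h : ∀ b, c' b = c (-x) → b = -y) {v : V} {w : W} (hw : c' w = c v) :
    c' (w + y) = c (v + x) := by
  obtain ⟨a, b, rfl, ha, hb⟩ := M.exists_add (w := w) (x := v + x) (y := -x)
    (hw.trans (by congr 1; abel))
  rw [h b hb, neg_add_cancel_right, ha]

theorem eq_of_isPM (M : AlgMatch c c') (h2 : ∀ w : W, w + w = 0 → w = 0) {x : V} {y : W}
    (hx : IsPM c x) (hy : c' y = c x) (hs : c (-x) ≠ c x) (b : W) (hb : c' b = c x) : b = y := by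
  rcases M.isPM h2 hx hy b (hb.trans hy.symm) with rfl | rfl
  · rfl
  · exact absurd ((M.color_neg hy).symm.trans hb) hs

theorem realizable_of_isPM_of_isPM (M : AlgMatch c c') (hV : Nat.card V = 9)
    (h2 : ∀ w : W, w + w = 0 → w = 0) {x u : V} (hx3 : 3 • x = 0) (hu3 : 3 • u = 0)
    (hu0 : u ≠ 0) (hx0 : x ≠ 0) (hxu : x ≠ u) (hxu' : x ≠ -u) (hx : IsPM c x) (hu : IsPM c u) :
    Realizable c c' := by
  obtain ⟨y, hy⟩ := M.exists_color x
  obtain ⟨u', hu'⟩ := M.exists_color u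
  have hy3 := M.three_smul h2 hx hx3 hy
  have hu3' := M.three_smul h2 hu hu3 hu'
  have hneg : ∀ {a : V} {b : W}, (∀ s, c' s = c a → s = b) → ∀ s, c' s = c (-a) → s = -b := by
    intro a b h s hs
    rw [← h (-s) (by rw [M.color_neg hs, neg_neg]), neg_neg]
  by_cases hsx : c (-x) = c x
  swap
  · have h1 : ∀ {v w}, c' w = c v → c' (w + y) = c (v + x) := fun h =>
      M.singleton_translate (hneg (M.eq_of_isPM h2 hx hy hsx)) h
    refine M.realizable_of_basis hV hx3 hu3 hy3 hu3' hu0 hx0 hxu hxu' hy hu' ?_ ?_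
    · rw [add_comm, h1 hu', add_comm]
    · rw [sub_eq_neg_add, h1 (M.color_neg hu'), sub_eq_neg_add]
  by_cases hsu : c (-u) = c u
  swap
  · have hs := M.eq_of_isPM h2 hu hu' hsu
    refine M.realizable_of_basis hV hx3 hu3 hy3 hu3' hu0 hx0 hxu hxu' hy hu' ?_ ?_
    · exact M.singleton_translate (hneg hs) hy
    · rw [sub_eq_add_neg, sub_eq_add_neg]
      exact M.singleton_translate (hneg (hneg hs)) hy
  have hsym : c (-(x + u)) = c (x + u) := by
    obtain ⟨s, t, hst, hs, ht⟩ := M.self.exists_add (w := -x) (x := x + u) (y := -u)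
      (hsx.trans (by congr 1; abel))
    obtain ⟨s', t', hst', hs', ht'⟩ := M.self.exists_add (w := -u) (x := x + u) (y := -x)
      (hsu.trans (by congr 1; abel))
    rcases hu t (ht.trans hsu) with rfl | rfl
    · rw [← hs]
      congr 1
      linear_combination (norm := module) hst
    rcases hx t' (ht'.trans hsx) with rfl | rfl
    · rw [← hs']
      congr 1
      linear_combination (norm := module) hst'
    obtain rfl : s = -s' := by linear_combination (norm := module) -hst - hst'
    exact (M.self.color_neg hs').symm.trans hs
  have main : ∀ u', c' u' = c u → 3 • u' = 0 → c' (y + u') = c (x + u) → Realizable c c' := by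
    intro u' hu' hu3' hadd
    refine M.realizable_of_basis hV hx3 hu3 hy3 hu3' hu0 hx0 hxu hxu' hy hu' hadd ?_
    obtain ⟨s, t, hst, hs, ht⟩ := M.exists_add (w := y) (x := x - u) (y := u)
      (hy.trans (by congr 1; abel))
    rcases M.isPM h2 hu hu' t (ht.trans hu'.symm) with rfl | rfl
    · rw [← hs, hst, add_sub_cancel_right]
    · obtain rfl : s = y + u' := by rw [hst]; abel
      obtain ⟨s', t', hst', hs', ht'⟩ := M.symm.exists_add (w := x) (x := y - u') (y := u')
        (hy.symm.trans (by congr 1; abel))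
      rcases hu t' (ht'.trans hu') with rfl | rfl
      · rw [← hs', hst', add_sub_cancel_right]
      · rw [← hs', ← hs, hadd, hst']
        congr 1
        abel
  obtain ⟨w, hw⟩ := M.exists_color (x + u)
  have hw' := (M.color_neg hw).trans hsym
  obtain ⟨s, t, rfl, hs, ht⟩ := M.exists_add hw
  have hu'n : c' (-u') = c u := (M.color_neg hu').trans hsu
  have hu3n : 3 • -u' = 0 := by rw [smul_neg, hu3', neg_zero]
  rcases M.isPM h2 hx hy s (hs.trans hy.symm) with rfl | rfl <;>
    rcases M.isPM h2 hu hu' t (ht.trans hu'.symm) with rfl | rfl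
  · exact main _ hu' hu3' hw
  · exact main _ hu'n hu3n hw
  · exact main _ hu'n hu3n (by rw [← hw']; congr 1; abel)
  · exact main _ hu' hu3' (by rw [← hw']; congr 1; abel)

theorem _root_.zsmul_cases_of_three_smul {u : V} (hu3 : 3 • u = 0) (m : ℤ) :
    m • u = 0 ∨ m • u = u ∨ m • u = -u := by
  have h : m % 3 = 0 ∨ m % 3 = 1 ∨ m % 3 = 2 := by omega
  rcases h with h | h | h
  · obtain ⟨q, rfl⟩ : ∃ q, m = 3 * q := ⟨m / 3, by omega⟩
    exact .inl (by linear_combination (norm := module) q • hu3)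
  · obtain ⟨q, rfl⟩ : ∃ q, m = 3 * q + 1 := ⟨m / 3, by omega⟩
    exact .inr (.inl (by linear_combination (norm := module) q • hu3))
  · obtain ⟨q, rfl⟩ : ∃ q, m = 3 * q - 1 := ⟨m / 3 + 1, by omega⟩
    exact .inr (.inr (by linear_combination (norm := module) q • hu3))

theorem _root_.exists_three_smul_eq_zsmul (hV : Nat.card V = 9) (h9 : ∀ v : V, 9 • v = 0)
    {u x : V} (hu3 : 3 • u = 0) (hu0 : u ≠ 0) (hx : ∀ m : ℤ, x ≠ m • u) :
    ∃ j : ℤ, 3 • x = j • u := by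
  obtain ⟨i, j, rfl | rfl | rfl, -, h⟩ := exists_eq_zsmul_add_zsmul hV hu3 hu0
    (by simpa using hx 0) (by simpa using hx 1) (by simpa using hx (-1)) (3 • x)
  · exact ⟨j, by rw [h]; module⟩
  · exact absurd (by linear_combination (norm := module) h9 x - 4 • h) (hx (-4 * j))
  · exact absurd (by linear_combination (norm := module) h9 x - 2 • h) (hx (-2 * j))

theorem _root_.color_add_zsmul {u : V}
    (h : ∀ v, (∀ m : ℤ, v ≠ m • u) → c (v + u) = c v) {x : V} (hx : ∀ m : ℤ, x ≠ m • u) (n : ℤ) :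
    c (x + n • u) = c x := by
  have hx' : ∀ n m : ℤ, x + n • u ≠ m • u := fun n m h =>
    hx (m - n) (by linear_combination (norm := module) h)
  induction n with
  | zero => simp
  | succ n ih =>
    rw [← ih, ← h _ (hx' n)]
    congr 1
    module
  | pred n ih =>
    rw [← ih, ← h _ (hx' _)]
    congr 1
    module

theorem _root_.color_zsmul_add_zsmul {u : V}
    (h : ∀ v, (∀ m : ℤ, v ≠ m • u) → c (v + u) = c v) {x : V} (hx : ∀ m : ℤ, x ≠ m • u)
    (h3 : ∃ j : ℤ, 3 • x = j • u) (k m : ℤ) :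
    (k % 3 = 1 → c (k • x + m • u) = c x) ∧ (k % 3 = 2 → c (k • x + m • u) = c (-x)) := by
  obtain ⟨j, hj⟩ := h3
  have hx' : ∀ m : ℤ, -x ≠ m • u := fun m h => hx (-m) (by rw [neg_smul, ← h, neg_neg])
  constructor
  · intro hk
    obtain ⟨q, rfl⟩ : ∃ q, k = 3 * q + 1 := ⟨k / 3, by omega⟩
    rw [← color_add_zsmul h hx (q * j + m)]
    congr 1
    linear_combination (norm := module) q • hj
  · intro hk
    obtain ⟨q, rfl⟩ : ∃ q, k = 3 * q - 1 := ⟨k / 3 + 1, by omega⟩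
    rw [← color_add_zsmul h hx' (q * j + m)]
    congr 1
    linear_combination (norm := module) q • hj

theorem ne_zsmul (M : AlgMatch c c') {u x : V} {u' y : W} (hu3' : 3 • u' = 0)
    (hu : IsPM c u) (hu' : c' u' = c u) (hy : c' y = c x) (hx : ∀ m : ℤ, x ≠ m • u) (m : ℤ) :
    y ≠ m • u' := by
  intro h
  rcases zsmul_cases_of_three_smul hu3' m with h' | h' | h' <;> rw [h'] at h
  · exact hx 0 (by simpa using (M.eq_zero_iff hy).1 h)
  · rcases hu x (hy.symm.trans (h ▸ hu')) with h | h
    · exact hx 1 (by simpa using h)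
    · exact hx (-1) (by simpa using h)
  · have := M.color_neg hy
    rw [h, neg_neg] at this
    rcases hu (-x) (this.symm.trans hu') with h | h
    · exact hx (-1) (by rw [neg_one_smul, ← h, neg_neg])
    · exact hx 1 (by simpa using h)

theorem realizable_of_wreath (M : AlgMatch c c') (hV : Nat.card V = 9)
    (hW : Nat.card W = 9) (h9 : ∀ v : V, 9 • v = 0) (h9' : ∀ v : W, 9 • v = 0)
    {u x : V} (hu3 : 3 • u = 0) (hu0 : u ≠ 0) (hu : IsPM c u) (hx : ∀ m : ℤ, x ≠ m • u)
    (h : ∀ v, (∀ m : ℤ, v ≠ m • u) → c (v + u) = c v) : Realizable c c' := by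
  have h2' : ∀ v : W, v + v = 0 → v = 0 := fun v hv => by
    linear_combination (norm := module) h9' v - 4 • hv
  obtain ⟨y, hy⟩ := M.exists_color x
  obtain ⟨u', hu'⟩ := M.exists_color u
  have hu3' := M.three_smul h2' hu hu3 hu'
  have hu0' : u' ≠ 0 := fun h => hu0 ((M.eq_zero_iff hu').1 h)
  have hp := M.isPM h2' hu hu'
  have hy' := M.ne_zsmul hu3' hu hu' hy hx
  have h' : ∀ w, (∀ m : ℤ, w ≠ m • u') → c' (w + u') = c' w := by
    intro w hw
    obtain ⟨v, hv⟩ := M.symm.exists_color w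
    have hvu := M.symm.ne_zsmul hu3 hp hu'.symm hv hw
    obtain ⟨e, he⟩ := M.exists_equiv v w hv
    have key : ∀ m : ℤ, e (m • u) = -u' → c' (w + u') = c' w := fun m hm => by
      have h1 := (he (m • u)).2
      rw [hm, sub_neg_eq_add] at h1
      rw [h1, ← hv, ← color_add_zsmul h hvu (-m)]
      congr 1
      module
    rcases hp (e u) ((he u).1.trans hu'.symm) with h1 | h1
    · rcases hp (-e (-u)) ((M.color_neg (he (-u)).1).trans (by rw [neg_neg, hu'])) with h3 | h3
      · exact key (-1) (by rw [neg_one_smul, ← h3, neg_neg])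
      · have h4 : e (-u) = e u := by rw [h1, ← neg_neg (e (-u)), h3, neg_neg]
        have h5 := e.injective h4
        exact absurd (by linear_combination (norm := module) hu3 + h5) hu0
    · exact key 1 (by rw [one_smul, h1])
  choose i j hi hj hij using fun v => exists_eq_zsmul_add_zsmul hV hu3 hu0
    (by simpa using hx 0) (by simpa using hx 1) (by simpa using hx (-1)) v
  refine ⟨fun v => i v • y + j v • u', fun g k => ?_⟩
  have hgk : k - g = (i k - i g) • x + (j k - j g) • u := by
    nth_rw 1 [hij k, hij g]
    module
  have hgk' : i k • y + j k • u' - (i g • y + j g • u') =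
    (i k - i g) • y + (j k - j g) • u' := by module
  rw [hgk, hgk']
  have hk : (i k - i g) % 3 = 1 ∨ (i k - i g) % 3 = 2 ∨ i k - i g = 0 := by
    have := hi k
    have := hi g
    omega
  have hVc := color_zsmul_add_zsmul h hx (exists_three_smul_eq_zsmul hV h9 hu3 hu0 hx)
    (i k - i g) (j k - j g)
  have hWc := color_zsmul_add_zsmul h' hy' (exists_three_smul_eq_zsmul hW h9' hu3' hu0' hy')
    (i k - i g) (j k - j g)
  rcases hk with hk | hk | hk
  · rw [hVc.1 hk, hWc.1 hk, hy]
  · rw [hVc.2 hk, hWc.2 hk, M.color_neg hy]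
  · rw [hk, zero_smul, zero_smul, zero_add, zero_add]
    obtain ⟨q, m, hm, hm'⟩ : ∃ q m : ℤ, j k - j g = 3 * q + m ∧ (m = 0 ∨ m = 1 ∨ m = -1) := by
      have h3 : (j k - j g) % 3 = 0 ∨ (j k - j g) % 3 = 1 ∨ (j k - j g) % 3 = 2 := by omega
      rcases h3 with h3 | h3 | h3
      · exact ⟨(j k - j g) / 3, 0, by omega, by simp⟩
      · exact ⟨(j k - j g) / 3, 1, by omega, by simp⟩
      · exact ⟨(j k - j g) / 3 + 1, -1, by omega, by simp⟩
    rw [hm, show (3 * q + m) • u = m • u by linear_combination (norm := module) q • hu3,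
      show (3 * q + m) • u' = m • u' by linear_combination (norm := module) q • hu3']
    rcases hm' with rfl | rfl | rfl
    · simpa using M.zero
    · simpa using hu'
    · simpa using M.color_neg hu'

theorem color_add_ne (M : AlgMatch c c') {u x y : V} (hu : IsPM c u)
    (h1 : c (x + u) ≠ c x) (h2 : c (x - u) ≠ c x) (hy : c y = c x) : c (y + u) ≠ c y := by
  intro h
  obtain ⟨s, t, hst, hs, ht⟩ := M.self.exists_add (w := x) (x := y + u) (y := -u)
    (hy.symm.trans (by congr 1; abel))
  have hs' := hs.trans (h.trans hy)
  rcases hu (-t) ((M.self.color_neg ht).trans (by rw [neg_neg])) with h | h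
  · apply h1
    rw [← hs']
    congr 1
    linear_combination (norm := module) hst - h
  · apply h2
    rw [← hs']
    congr 1
    linear_combination (norm := module) hst - h

theorem isPM_neg (M : AlgMatch c c') {u : V} (hu : IsPM c u) : IsPM c (-u) := by
  intro y hy
  have := hu (-y) ((M.self.color_neg hy).trans (by rw [neg_neg]))
  rw [neg_neg]
  rw [neg_eq_iff_eq_neg, neg_inj] at this
  exact this

/-- If `x` differs in colour from both `x + u` and `x - u`, its colour class is contained in
`{x, -x, -x + u, -x - u}`. -/
theorem class_cases (M : AlgMatch c c') (hV : Nat.card V = 9) {u x y : V} (hu3 : 3 • u = 0)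
    (hu0 : u ≠ 0) (hu : IsPM c u) (hx : ∀ m : ℤ, x ≠ m • u)
    (h1 : c (x + u) ≠ c x) (h2 : c (x - u) ≠ c x) (hy : c y = c x) :
    y = x ∨ y = -x ∨ y = -x + u ∨ y = -x - u := by
  have hyu := M.self.ne_zsmul hu3 hu rfl hy hx
  obtain ⟨i, j, rfl | rfl | rfl, hj, h⟩ := exists_eq_zsmul_add_zsmul hV hu3 hu0
    (by simpa using hx 0) (by simpa using hx 1) (by simpa using hx (-1)) y
  · exact absurd (by rw [h]; module) (hyu j)
  · rcases hj with rfl | rfl | rfl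
    · left
      rw [h]
      module
    · refine absurd ?_ h1
      rw [← hy, h]
      congr 1
      module
    · refine absurd ?_ h2
      rw [← hy, h]
      congr 1
      module
  · right
    rcases hj with rfl | rfl | rfl
    · left
      rw [h]
      module
    · right; left
      rw [h]
      module
    · right; right
      rw [h]
      module

theorem isPM_add (M : AlgMatch c c') (hV : Nat.card V = 9) {u x : V} (hu3 : 3 • u = 0)
    (hu0 : u ≠ 0) (hu : IsPM c u) (hx : ∀ m : ℤ, x ≠ m • u)
    (h1 : c (x + u) ≠ c x) (h2 : c (x - u) ≠ c x) (hy : c (-x + u) = c x) : IsPM c (x + u) := by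
  have hneg := M.self.color_neg hy
  have h1' : c (-x + u) ≠ c (-x) := fun h => by
    have := M.self.color_neg h
    rw [neg_neg] at this
    exact h2 (by rw [← this]; congr 1; abel)
  have h2' : c (-x - u) ≠ c (-x) := fun h => by
    have := M.self.color_neg h
    rw [neg_neg] at this
    exact h1 (by rw [← this]; congr 1; abel)
  have hsub : c (x - u) = c (-x) := by
    rw [← hneg]
    congr 1
    abel
  have hne : c (x - u) ≠ c (x + u) := fun h => by
    refine M.color_add_ne hu h1' h2' (y := x + u) (by rw [← h, hsub]) ?_
    rw [← h]
    congr 1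
    linear_combination (norm := module) hu3
  have hxu : ∀ m : ℤ, x + u ≠ m • u := fun m h =>
    hx (m - 1) (by linear_combination (norm := module) h)
  intro w hw
  have h3 : c (x + u + u) ≠ c (x + u) := by
    rwa [show x + u + u = x - u by linear_combination (norm := module) hu3]
  have h4 : c (x + u - u) ≠ c (x + u) := by
    rw [add_sub_cancel_right]
    exact h1.symm
  rcases M.class_cases hV hu3 hu0 hu hxu h3 h4 hw with h | h | h | h
  · exact .inl h
  · exact .inr h
  · refine absurd ?_ hne
    rw [hsub, ← hw, h]
    congr 1
    abel
  · refine absurd ?_ h1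
    rw [← hw, h, ← hy]
    congr 1
    linear_combination (norm := module) -hu3

theorem exists_isPM_of_color_ne (M : AlgMatch c c') (hV : Nat.card V = 9) {u x : V}
    (hu3 : 3 • u = 0) (hu0 : u ≠ 0) (hu : IsPM c u) (hx : ∀ m : ℤ, x ≠ m • u)
    (h : c (x + u) ≠ c x) : ∃ z, (∀ m : ℤ, z ≠ m • u) ∧ IsPM c z := by
  have main : ∀ x, (∀ m : ℤ, x ≠ m • u) → c (x + u) ≠ c x → c (x - u) ≠ c x →
      ∃ z, (∀ m : ℤ, z ≠ m • u) ∧ IsPM c z := by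
    intro x hx h1 h2
    by_cases hp : IsPM c x
    · exact ⟨x, hx, hp⟩
    rw [IsPM] at hp
    push Not at hp
    obtain ⟨y, hy, hyx, hyx'⟩ := hp
    rcases M.class_cases hV hu3 hu0 hu hx h1 h2 hy with h | h | rfl | rfl
    · exact absurd h hyx
    · exact absurd h hyx'
    · exact ⟨x + u, fun m h => hx (m - 1) (by linear_combination (norm := module) h),
        M.isPM_add hV hu3 hu0 hu hx h1 h2 hy⟩
    · refine ⟨x + -u, fun m h => hx (m + 1) (by linear_combination (norm := module) h),
        M.isPM_add hV (by rw [smul_neg, hu3, neg_zero]) (neg_ne_zero.2 hu0) (M.isPM_neg hu)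
          (fun m h => hx (-m) (by rw [h]; module)) ?_ ?_ ?_⟩
      · rwa [← sub_eq_add_neg]
      · rwa [sub_neg_eq_add]
      · rwa [← sub_eq_add_neg]
  by_cases h2 : c (x - u) = c x
  · refine main (x + u) (fun m h => hx (m - 1) (by linear_combination (norm := module) h)) ?_ ?_
    · rw [show x + u + u = x - u by linear_combination (norm := module) hu3, h2]
      exact h.symm
    · rw [add_sub_cancel_right]
      exact h.symm
  · exact main x hx h h2

theorem exists_three_of_forall_not_isPM (M : AlgMatch c c') (hp : ∀ x ≠ 0, ¬ IsPM c x) {x : V}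
    (hx : x ≠ 0) : ∃ y z, c y = c x ∧ c z = c x ∧ y ≠ x ∧ z ≠ x ∧ y ≠ z := by
  have h1 := hp x hx
  rw [IsPM] at h1
  push Not at h1
  obtain ⟨y, hy, hyx, -⟩ := h1
  by_contra! hcon
  have hcl : ∀ z, c z = c x → z = x ∨ z = y := fun z hz => by
    by_contra! hne
    exact hne.2 (hcon y z hy hz hyx hne.1).symm
  refine hp (x - y) (sub_ne_zero.2 hyx.symm) fun w hw => ?_
  have hw0 : w ≠ 0 := fun h => hyx.symm (sub_eq_zero.1 ((M.self.eq_zero_iff hw).1 h))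
  obtain ⟨a, b, rfl, ha, hb⟩ := M.self.exists_add (w := w) (hw.trans (by rw [sub_eq_add_neg]))
  have hb' : c (-b) = c x := by rw [M.self.color_neg hb, neg_neg, hy]
  rcases hcl a ha with rfl | rfl <;> rcases hcl _ hb' with h | h
  · exact absurd (by rw [← h, neg_add_cancel]) hw0
  · left
    rw [← h, sub_neg_eq_add]
  · right
    rw [← h]
    abel
  · exact absurd (by rw [← h, neg_add_cancel]) hw0

theorem color_neg_eq_of_forall_not_isPM (M : AlgMatch c c') (hV : Nat.card V = 9)
    (hp : ∀ x ≠ 0, ¬ IsPM c x) (x : V) : c (-x) = c x := by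
  classical
  have hfin : Finite V := Nat.finite_of_card_ne_zero (by omega)
  have := Fintype.ofFinite V
  rw [Nat.card_eq_fintype_card] at hV
  by_contra hx
  have hx0 : x ≠ 0 := by
    rintro rfl
    simp at hx
  set S : V → Finset V := fun x => Finset.univ.filter fun y => c y = c x with hS
  have hmem : ∀ x y, y ∈ S x ↔ c y = c x := by simp [hS]
  have hcard : ∀ x ≠ 0, 3 ≤ (S x).card := by
    intro x hx
    obtain ⟨y, z, hy, hz, hyx, hzx, hyz⟩ := M.exists_three_of_forall_not_isPM hp hx
    have h3 : ({x, y, z} : Finset V).card = 3 :=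
      Finset.card_eq_three.2 ⟨x, y, z, hyx.symm, hzx.symm, hyz, rfl⟩
    rw [← h3]
    refine Finset.card_le_card ?_
    intro t
    simp only [Finset.mem_insert, Finset.mem_singleton, hmem]
    rintro (rfl | rfl | rfl)
    exacts [rfl, hy, hz]
  have hdisj : ∀ a b, c a ≠ c b → Disjoint (S a) (S b) := by
    intro a b hab
    rw [Finset.disjoint_left]
    intro t ht ht'
    rw [hmem] at ht ht'
    exact hab (ht.symm.trans ht')
  have hnegcard : (S (-x)).card = (S x).card := by
    refine Finset.card_bij (fun a _ => -a) ?_ (fun a _ b _ h => neg_injective h) ?_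
    · intro a ha
      rw [hmem] at ha ⊢
      rw [M.self.color_neg ha, neg_neg]
    · intro a ha
      rw [hmem] at ha
      exact ⟨-a, by rw [hmem, M.self.color_neg ha], neg_neg a⟩
  set N : Finset V := Finset.univ.erase 0 with hN
  have hNcard : N.card = 8 := by
    rw [hN, Finset.card_erase_of_mem (Finset.mem_univ _), Finset.card_univ, hV]
  have hSN : ∀ a ≠ 0, S a ⊆ N := by
    intro a ha t ht
    rw [hmem] at ht
    simp only [hN, Finset.mem_erase, Finset.mem_univ, and_true]
    exact fun h => ha ((M.self.eq_zero_iff ht).1 h)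
  have hnx0 : -x ≠ 0 := neg_ne_zero.2 hx0
  have hd := hdisj x (-x) (fun h => hx h.symm)
  have hun : S x ∪ S (-x) = N := by
    refine Finset.Subset.antisymm (Finset.union_subset (hSN x hx0) (hSN _ hnx0)) fun r hr => ?_
    by_contra hr'
    simp only [Finset.mem_union, hmem, not_or] at hr'
    have hr0 : r ≠ 0 := (Finset.mem_erase.1 hr).1
    have hd' : Disjoint (S x ∪ S (-x)) (S r) :=
      Finset.disjoint_union_left.2
        ⟨hdisj _ _ (fun h => hr'.1 h.symm), hdisj _ _ (fun h => hr'.2 h.symm)⟩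
    have hle := Finset.card_le_card
      (Finset.union_subset (Finset.union_subset (hSN x hx0) (hSN _ hnx0)) (hSN r hr0))
    rw [Finset.card_union_of_disjoint hd', Finset.card_union_of_disjoint hd] at hle
    have := hcard x hx0
    have := hcard r hr0
    omega
  have hSx : (S x).card = 4 := by
    have := congrArg Finset.card hun
    rw [Finset.card_union_of_disjoint hd] at this
    omega
  have hconst : ∀ v v', c v = c v' →
      (Finset.univ.filter fun a => c a = c x ∧ c (a - v) = c x).card =
        (Finset.univ.filter fun a => c a = c x ∧ c (a - v') = c x).card := by
    intro v v' h
    obtain ⟨e, he⟩ := M.self.exists_equiv v v' h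
    refine Finset.card_equiv e fun a => ?_
    have h1 : c (e a - v') = c (a - v) := by
      simpa using M.self.color_neg (he a).2
    simp [(he a).1, h1]
  have hconst' : ∀ v,
      (Finset.univ.filter fun a => c a = c x ∧ c (a - -v) = c x).card =
        (Finset.univ.filter fun a => c a = c x ∧ c (a - v) = c x).card := by
    intro v
    refine Finset.card_equiv (Equiv.addRight v) fun a => ?_
    simp [and_comm]
  have hsum := Finset.card_eq_sum_card_fiberwise (s := (S x).offDiag) (t := N)
    (f := fun q => q.1 - q.2) (by
      rintro ⟨a, b⟩ hab
      have hab := (Finset.mem_offDiag.1 hab).2.2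
      simpa [hN, sub_eq_zero] using hab)
  have hfib : ∀ v ∈ N, ((S x).offDiag.filter fun q => q.1 - q.2 = v).card =
      (Finset.univ.filter fun a => c a = c x ∧ c (a - x) = c x).card := by
    intro v hv
    trans (Finset.univ.filter fun a => c a = c x ∧ c (a - v) = c x).card
    · refine Finset.card_bij (fun q _ => q.1) ?_ ?_ ?_
      · rintro ⟨a, b⟩ h
        simp only [Finset.mem_filter, Finset.mem_offDiag, hmem] at h
        obtain ⟨⟨ha, hb, -⟩, rfl⟩ := h
        simpa [ha] using hb
      · rintro ⟨a, b⟩ h ⟨a', b'⟩ h' rfl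
        have := (Finset.mem_filter.1 h).2.trans (Finset.mem_filter.1 h').2.symm
        simpa using this
      · intro a ha
        simp only [Finset.mem_filter, Finset.mem_univ, true_and] at ha
        refine ⟨(a, a - v), ?_, rfl⟩
        simp only [Finset.mem_filter, Finset.mem_offDiag, hmem, sub_sub_cancel, and_true]
        refine ⟨ha.1, ha.2, fun h => (Finset.mem_erase.1 hv).1 (sub_eq_self.1 h.symm)⟩
    · rw [← hun, Finset.mem_union, hmem, hmem] at hv
      rcases hv with h | h
      · exact hconst _ _ h
      · rw [hconst _ _ h, hconst']
  rw [Finset.sum_congr rfl hfib, Finset.offDiag_card, hSx, Finset.sum_const, hNcard] at hsum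
  simp only [smul_eq_mul] at hsum
  omega

theorem _root_.card_pm_pair {V : Type*} [AddCommGroup V] [DecidableEq V]
    (h2 : ∀ v : V, v + v = 0 → v = 0) {x b : V}
    (hx : x ≠ 0) (hb : b ≠ 0) (hbx : b ≠ x) (hbx' : b ≠ -x) :
    ({x, -x, b, -b} : Finset V).card = 4 := by
  have h1 : ∀ v : V, v ≠ 0 → v ≠ -v := fun v hv h => hv (h2 v (by nth_rw 2 [h]; simp))
  rw [Finset.card_insert_of_notMem, Finset.card_insert_of_notMem, Finset.card_pair (h1 b hb)]
  · simp only [Finset.mem_insert, Finset.mem_singleton, neg_inj, not_or]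
    exact ⟨hbx'.symm, hbx.symm⟩
  · simp only [Finset.mem_insert, Finset.mem_singleton, not_or]
    exact ⟨h1 x hx, hbx.symm, fun h => hbx' (by rw [h, neg_neg])⟩

theorem classes_of_forall_not_isPM (M : AlgMatch c c') (hV : Nat.card V = 9)
    (h2 : ∀ v : V, v + v = 0 → v = 0) (hp : ∀ x ≠ 0, ¬ IsPM c x) (hs : ∀ x, c (-x) = c x)
    {x z b : V} (hx : x ≠ 0) (hz : z ≠ 0) (hxz : c x ≠ c z) (hb : c b = c x)
    (hbx : b ≠ x) (hbx' : b ≠ -x) :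
    (∀ t, c t = c x → t = x ∨ t = -x ∨ t = b ∨ t = -b) ∧ ∀ t ≠ 0, c t ≠ c x → c t = c z := by
  classical
  have hfin : Finite V := Nat.finite_of_card_ne_zero (by omega)
  have := Fintype.ofFinite V
  rw [Nat.card_eq_fintype_card] at hV
  have hd := hp z hz
  rw [IsPM] at hd
  push Not at hd
  obtain ⟨d, hd, hdz, hdz'⟩ := hd
  have hb0 : b ≠ 0 := fun h => hx ((M.self.eq_zero_iff hb).1 h)
  have hd0 : d ≠ 0 := fun h => hz ((M.self.eq_zero_iff hd).1 h)
  have hA : ∀ t ∈ ({x, -x, b, -b} : Finset V), c t = c x := by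
    simp [hs, hb]
  have hB : ∀ t ∈ ({z, -z, d, -d} : Finset V), c t = c z := by
    simp [hs, hd]
  have hdisj : Disjoint ({x, -x, b, -b} : Finset V) {z, -z, d, -d} :=
    Finset.disjoint_left.2 fun t ht ht' => hxz ((hA t ht).symm.trans (hB t ht'))
  have hcard : ({x, -x, b, -b} ∪ {z, -z, d, -d} : Finset V).card = 8 := by
    rw [Finset.card_union_of_disjoint hdisj, card_pm_pair h2 hx hb0 hbx hbx',
      card_pm_pair h2 hz hd0 hdz hdz']
  have hun : ({x, -x, b, -b} ∪ {z, -z, d, -d} : Finset V) = Finset.univ.erase 0 := by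
    refine Finset.eq_of_subset_of_card_le ?_ ?_
    · intro t ht
      rw [Finset.mem_erase]
      refine ⟨?_, Finset.mem_univ _⟩
      rintro rfl
      rcases Finset.mem_union.1 ht with h | h
      · exact hx (M.eq_zero _ (hA _ h).symm)
      · exact hz (M.eq_zero _ (hB _ h).symm)
    · rw [hcard, Finset.card_erase_of_mem (Finset.mem_univ _), Finset.card_univ, hV]
  have hcase : ∀ t ≠ 0, t ∈ ({x, -x, b, -b} : Finset V) ∨ t ∈ ({z, -z, d, -d} : Finset V) :=
    fun t ht => Finset.mem_union.1 (hun ▸ Finset.mem_erase.2 ⟨ht, Finset.mem_univ t⟩)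
  constructor
  · intro t ht
    rcases hcase t (fun h => hx ((M.self.eq_zero_iff ht).1 h)) with h | h
    · simpa using h
    · exact absurd (ht.symm.trans (hB t h)) hxz
  · intro t ht hne
    rcases hcase t ht with h | h
    · exact absurd (hA t h) hne
    · exact hB t h

theorem _root_.card_filter_ne_of_zmod_nine : ∀ b : ZMod 9, b ≠ 0 → b ≠ 1 → b ≠ -1 →
    (Finset.univ.filter fun t : ZMod 9 => t ∈ ({1, -1, b, -b} : Finset (ZMod 9)) ∧
      1 - t ∈ ({1, -1, b, -b} : Finset (ZMod 9))).card ≠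
    (Finset.univ.filter fun t : ZMod 9 => t ∈ ({1, -1, b, -b} : Finset (ZMod 9)) ∧
      b - t ∈ ({1, -1, b, -b} : Finset (ZMod 9))).card := by
  decide

theorem three_smul_eq_zero_of_class (M : AlgMatch c c') (hV : Nat.card V = 9)
    (h9 : ∀ v : V, 9 • v = 0) (hs : ∀ x, c (-x) = c x) {x b : V} (hb0 : b ≠ 0) (hb : c b = c x)
    (hbx : b ≠ x) (hbx' : b ≠ -x) (h : ∀ t, c t = c x → t = x ∨ t = -x ∨ t = b ∨ t = -b) :
    3 • x = 0 := by
  by_contra hx3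
  have hfin : Finite V := Nat.finite_of_card_ne_zero (by omega)
  have hord : addOrderOf x = 3 ^ (1 + 1) :=
    addOrderOf_eq_prime_pow (by simpa using hx3) (by simpa using h9 x)
  have htop : AddSubgroup.zmultiples x = ⊤ :=
    AddSubgroup.eq_top_of_card_eq _ (by rw [Nat.card_zmultiples, hord, hV]; rfl)
  set r := zmodAddEquivOfGenerator (fun t => htop ▸ AddSubgroup.mem_top t) hV with hr
  have hr1 : r 1 = x := by simp [hr]
  obtain ⟨β, rfl⟩ := r.surjective b
  have hmem : ∀ t, t ∈ ({1, -1, β, -β} : Finset (ZMod 9)) ↔ c (r t) = c x := by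
    intro t
    simp only [Finset.mem_insert, Finset.mem_singleton]
    constructor
    · rintro (rfl | rfl | rfl | rfl) <;> simp [hr1, hs, hb]
    · intro ht
      have := h _ ht
      rw [← hr1, ← map_neg, ← map_neg] at this
      simpa only [r.injective.eq_iff] using this
  obtain ⟨e, he⟩ := M.self.exists_equiv x (r β) hb.symm
  refine card_filter_ne_of_zmod_nine β ?_ ?_ ?_
    (Finset.card_equiv (r.toEquiv.trans (e.trans r.symm.toEquiv)) fun t => ?_)
  · rintro rfl
    simp at hb0
  · rintro rfl
    exact hbx hr1
  · rintro rfl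
    exact hbx' (by rw [map_neg, hr1])
  · have h1 := (he (r t)).1
    have h2 := (he (r t)).2
    simp only [Finset.mem_filter, Finset.mem_univ, true_and, hmem]
    simp [h1, h2, hr1]

theorem _root_.color_add_and_sub_of_class {x b z : V} (hx0 : x ≠ 0) (hb0 : b ≠ 0) (hbx : b ≠ x)
    (hbx' : b ≠ -x) (hx3 : 3 • x = 0) (hb3 : 3 • b = 0)
    (h : ∀ t, c t = c x → t = x ∨ t = -x ∨ t = b ∨ t = -b)
    (h' : ∀ t ≠ 0, c t ≠ c x → c t = c z) : c (x + b) = c z ∧ c (x - b) = c z := by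
  constructor
  · refine h' _ (fun h => hbx' (by linear_combination (norm := module) h)) fun ht => ?_
    rcases h _ ht with h | h | h | h
    · exact hb0 (by linear_combination (norm := module) h)
    · exact hbx (by linear_combination (norm := module) h - hx3)
    · exact hx0 (by linear_combination (norm := module) h)
    · exact hbx (by linear_combination (norm := module) -h + hb3)
  · refine h' _ (fun h => hbx (by linear_combination (norm := module) -h)) fun ht => ?_
    rcases h _ ht with h | h | h | h
    · exact hb0 (by linear_combination (norm := module) -h)
    · exact hbx' (by linear_combination (norm := module) -h + hx3)
    · exact hbx' (by linear_combination (norm := module) h + hb3)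
    · exact hx0 (by linear_combination (norm := module) h)

theorem realizable_of_forall_not_isPM (M : AlgMatch c c') (hV : Nat.card V = 9)
    (hW : Nat.card W = 9) (h9 : ∀ v : V, 9 • v = 0) (h9' : ∀ v : W, 9 • v = 0)
    (hp : ∀ x ≠ 0, ¬ IsPM c x) : Realizable c c' := by
  have h2 : ∀ v : V, v + v = 0 → v = 0 := fun v hv => by
    linear_combination (norm := module) h9 v - 4 • hv
  have h2' : ∀ v : W, v + v = 0 → v = 0 := fun v hv => by
    linear_combination (norm := module) h9' v - 4 • hv
  by_cases hconst : ∀ x z, x ≠ 0 → z ≠ 0 → c x = c z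
  · obtain ⟨e⟩ := M.equiv
    refine ⟨e, fun g k => ?_⟩
    obtain ⟨v, hv⟩ := M.symm.exists_color (e k - e g)
    rw [← hv]
    by_cases hgk : k = g
    · subst hgk
      rw [sub_self] at hv ⊢
      rw [hv, M.zero]
    · refine hconst _ _ (fun h => hgk (e.injective ?_)) (sub_ne_zero.2 hgk)
      rw [h] at hv
      exact sub_eq_zero.1 ((M.symm.eq_zero_iff hv).1 rfl)
  push Not at hconst
  obtain ⟨x, z, hx, hz, hxz⟩ := hconst
  have hp' : ∀ y ≠ 0, ¬ IsPM c' y := by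
    intro y hy hyp
    obtain ⟨v, hv⟩ := M.symm.exists_color y
    exact hp v (fun h => hy ((M.symm.eq_zero_iff hv).1 h)) (M.symm.isPM h2 hyp hv)
  have hs := M.color_neg_eq_of_forall_not_isPM hV hp
  have hs' := M.symm.color_neg_eq_of_forall_not_isPM hW hp'
  obtain ⟨y, hy⟩ := M.exists_color x
  obtain ⟨z', hz'⟩ := M.exists_color z
  have hy0 : y ≠ 0 := fun h => hx ((M.eq_zero_iff hy).1 h)
  have hz0' : z' ≠ 0 := fun h => hz ((M.eq_zero_iff hz').1 h)
  have hyz : c' y ≠ c' z' := by rwa [hy, hz']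
  have hb := hp x hx
  have hd := hp' y hy0
  rw [IsPM] at hb hd
  push Not at hb hd
  obtain ⟨b, hb, hbx, hbx'⟩ := hb
  obtain ⟨d, hd, hdy, hdy'⟩ := hd
  have hb0 : b ≠ 0 := fun h => hx ((M.self.eq_zero_iff hb).1 h)
  have hd0 : d ≠ 0 := fun h => hy0 ((M.symm.self.eq_zero_iff hd).1 h)
  obtain ⟨hcl, hcl'⟩ := M.classes_of_forall_not_isPM hV h2 hp hs hx hz hxz hb hbx hbx'
  obtain ⟨hdl, hdl'⟩ := M.symm.classes_of_forall_not_isPM hW h2' hp' hs' hy0 hz0' hyz hd hdy hdy'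
  have hx3 := M.three_smul_eq_zero_of_class hV h9 hs hb0 hb hbx hbx' hcl
  have hy3 := M.symm.three_smul_eq_zero_of_class hW h9' hs' hd0 hd hdy hdy' hdl
  have hb3 := M.three_smul_eq_zero_of_class hV h9 hs hx hb.symm hbx.symm
    (fun h => hbx' (by rw [h, neg_neg])) (fun t ht => by
      have := hcl t (ht.trans hb)
      tauto)
  have hd3 := M.symm.three_smul_eq_zero_of_class hW h9' hs' hy0 hd.symm hdy.symm
    (fun h => hdy' (by rw [h, neg_neg])) (fun t ht => by
      have := hdl t (ht.trans hd)
      tauto)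
  refine M.realizable_of_basis hV hx3 hb3 hy3 hd3 hb0 hx hbx.symm
    (fun h => hbx' (by rw [h, neg_neg])) hy (hd.trans (hy.trans hb.symm)) ?_ ?_
  · rw [(color_add_and_sub_of_class hx hb0 hbx hbx' hx3 hb3 hcl hcl').1,
      (color_add_and_sub_of_class hy0 hd0 hdy hdy' hy3 hd3 hdl hdl').1, hz']
  · rw [(color_add_and_sub_of_class hx hb0 hbx hbx' hx3 hb3 hcl hcl').2,
      (color_add_and_sub_of_class hy0 hd0 hdy hdy' hy3 hd3 hdl hdl').2, hz']

theorem realizable_of_card_nine (M : AlgMatch c c') (hV : Nat.card V = 9) : Realizable c c' := by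
  have hW : Nat.card W = 9 := by
    obtain ⟨e⟩ := M.equiv
    rw [← hV, Nat.card_congr e]
  have h9 : ∀ v : V, 9 • v = 0 := fun v => hV ▸ card_nsmul_eq_zero'
  have h9' : ∀ v : W, 9 • v = 0 := fun v => hW ▸ card_nsmul_eq_zero'
  have h2' : ∀ v : W, v + v = 0 → v = 0 := fun v hv => by
    linear_combination (norm := module) h9' v - 4 • hv
  by_cases hc : ∃ x, IsPM c x ∧ 3 • x ≠ 0
  · obtain ⟨x, hx, hx3⟩ := hc
    exact M.realizable_of_isPM_of_three_smul_ne hV h9 h9' hx hx3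
  push Not at hc
  by_cases hp : ∀ x ≠ 0, ¬ IsPM c x
  · exact M.realizable_of_forall_not_isPM hV hW h9 h9' hp
  push Not at hp
  obtain ⟨u, hu0, hu⟩ := hp
  have hu3 := hc u hu
  by_cases hw : ∀ v, (∀ m : ℤ, v ≠ m • u) → c (v + u) = c v
  · obtain ⟨x, hx⟩ : ∃ x, ∀ m : ℤ, x ≠ m • u := by
      by_contra! hcon
      have htop : AddSubgroup.zmultiples u = ⊤ := (AddSubgroup.eq_top_iff' _).2 fun x => by
        obtain ⟨m, rfl⟩ := hcon x
        exact AddSubgroup.zsmul_mem_zmultiples u m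
      have h1 := Nat.card_zmultiples u
      rw [htop, AddSubgroup.card_top, hV] at h1
      have := Nat.le_of_dvd (by norm_num) (addOrderOf_dvd_of_nsmul_eq_zero hu3)
      omega
    exact M.realizable_of_wreath hV hW h9 h9' hu3 hu0 hu hx hw
  · push Not at hw
    obtain ⟨x, hx, hne⟩ := hw
    obtain ⟨z, hz, hzp⟩ := M.exists_isPM_of_color_ne hV hu3 hu0 hu hx hne
    exact M.realizable_of_isPM_of_isPM hV h2' (hc z hzp) hu3 hu0 (by simpa using hz 0)
      (by simpa using hz 1) (by simpa using hz (-1)) hzp hu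

theorem exists_conv [Fintype V] [Fintype W] {R : Type*} [Semiring R] (M : AlgMatch c c')
    (a b : κ → R) : ∃ d : κ → R, (∀ v, d (c v) = ∑ x, a (c x) * b (c (v - x))) ∧
      ∀ w, d (c' w) = ∑ y, a (c' y) * b (c' (w - y)) := by
  have h : Function.FactorsThrough (fun v => ∑ x, a (c x) * b (c (v - x))) c := by
    intro v v' hv
    obtain ⟨e, he⟩ := M.self.exists_equiv v v' hv
    exact Fintype.sum_equiv e _ _ fun x => by rw [(he x).1, (he x).2]
  refine ⟨Function.extend c (fun v => ∑ x, a (c x) * b (c (v - x))) 0,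
    fun v => h.extend_apply 0 v, fun w => ?_⟩
  obtain ⟨v, hv⟩ := M.symm.exists_color w
  rw [← hv, h.extend_apply]
  obtain ⟨e, he⟩ := M.exists_equiv v w hv
  exact Fintype.sum_equiv e _ _ fun x => by rw [(he x).1, (he x).2]

theorem _root_.AddChar.eq_zero_of_forall_sum_mul_eq_zero [Fintype W] (f : W → ℂ)
    (h : ∀ ψ : AddChar W ℂ, ∑ w, f w * ψ w = 0) (w : W) : f w = 0 := by
  classical
  have h1 : ∑ ψ : AddChar W ℂ, ψ (-w) * ∑ x, f x * ψ x = 0 :=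
    Finset.sum_eq_zero fun ψ _ => by rw [h, mul_zero]
  simp_rw [Finset.mul_sum] at h1
  rw [Finset.sum_comm] at h1
  have h2 : ∀ x, ∑ ψ : AddChar W ℂ, ψ (-w) * (f x * ψ x) =
      if x = w then f x * Fintype.card W else 0 := by
    intro x
    have h3 : ∀ ψ : AddChar W ℂ, ψ (-w) * (f x * ψ x) = f x * ψ (x - w) := fun ψ => by
      rw [sub_eq_neg_add, AddChar.map_add_eq_mul]
      ring
    simp_rw [h3]
    rw [← Finset.mul_sum, AddChar.sum_apply_eq_ite]
    simp [sub_eq_zero]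
  simp_rw [h2] at h1
  simpa using h1

/-- Summation against a character is multiplicative on convolutions. -/
theorem _root_.AddChar.sum_conv_mul [Fintype V] (χ : AddChar V ℂ) (f g : V → ℂ) :
    ∑ v, (∑ x, f x * g (v - x)) * χ v = (∑ v, f v * χ v) * ∑ v, g v * χ v := by
  simp_rw [Finset.sum_mul]
  rw [Finset.sum_comm]
  refine Finset.sum_congr rfl fun x _ => ?_
  rw [Finset.mul_sum]
  refine Fintype.sum_equiv (Equiv.subRight x) _ _ fun v => ?_
  rw [Equiv.subRight_apply, mul_mul_mul_comm, ← AddChar.map_add_eq_mul, add_sub_cancel]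

/-- Every character of `V` agrees with a character of `W` on colour-invariant functions. -/
theorem exists_addChar [Fintype V] [Fintype W] (M : AlgMatch c c') (χ : AddChar V ℂ) :
    ∃ ψ : AddChar W ℂ, ∀ a : κ → ℂ, ∑ v, a (c v) * χ v = ∑ w, a (c' w) * ψ w := by
  classical
  by_contra! hcon
  let δ : κ → ℂ := fun k => if k = c 0 then 1 else 0
  have hδ : ∀ χ : AddChar V ℂ, ∑ v, δ (c v) * χ v = 1 := by
    intro χ
    rw [Finset.sum_eq_single 0 (fun v _ hv => ?_) (by simp)]
    · simp [δ]
    · have h : c v ≠ c 0 := fun h => hv (M.eq_zero v h)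
      simp [δ, h]
  have hδ' : ∀ ψ : AddChar W ℂ, ∑ w, δ (c' w) * ψ w = 1 := by
    intro ψ
    rw [Finset.sum_eq_single 0 (fun w _ hw => ?_) (by simp)]
    · simp [δ, M.zero]
    · have h : c' w ≠ c 0 := fun h => hw (M.eq_zero' w (h.trans M.zero.symm))
      simp [δ, h]
  have hsep : ∀ ψ : AddChar W ℂ, ∃ b : κ → ℂ, ∑ v, b (c v) * χ v ≠ 0 ∧
      ∑ w, b (c' w) * ψ w = 0 := by
    intro ψ
    obtain ⟨a, ha⟩ := hcon ψ
    refine ⟨fun k => a k - (∑ w, a (c' w) * ψ w) * δ k, ?_, ?_⟩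
    · simp_rw [sub_mul, mul_assoc]
      rw [Finset.sum_sub_distrib, ← Finset.mul_sum, hδ, mul_one]
      exact sub_ne_zero.2 ha
    · simp_rw [sub_mul, mul_assoc]
      rw [Finset.sum_sub_distrib, ← Finset.mul_sum, hδ', mul_one, sub_self]
  have hall : ∀ s : Finset (AddChar W ℂ), ∃ b : κ → ℂ, ∑ v, b (c v) * χ v ≠ 0 ∧
      ∀ ψ ∈ s, ∑ w, b (c' w) * ψ w = 0 := by
    intro s
    induction s using Finset.induction_on with
    | empty => exact ⟨δ, by rw [hδ]; exact one_ne_zero, by simp⟩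
    | insert ψ s _ ih =>
      obtain ⟨a, ha, ha'⟩ := ih
      obtain ⟨b, hb, hb'⟩ := hsep ψ
      obtain ⟨d, hd, hd'⟩ := M.exists_conv a b
      refine ⟨d, ?_, fun φ hφ => ?_⟩
      · simp_rw [hd]
        rw [χ.sum_conv_mul (fun x => a (c x)) fun x => b (c x)]
        exact mul_ne_zero ha hb
      · simp_rw [hd']
        rw [φ.sum_conv_mul (fun x => a (c' x)) fun x => b (c' x)]
        rcases Finset.mem_insert.1 hφ with rfl | h
        · rw [hb', mul_zero]
        · rw [ha' φ h, zero_mul]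
  obtain ⟨b, hb, hb'⟩ := hall Finset.univ
  refine hb (Finset.sum_eq_zero fun v _ => ?_)
  obtain ⟨w, hw⟩ := M.exists_color v
  rw [← hw, AddChar.eq_zero_of_forall_sum_mul_eq_zero (fun w => b (c' w))
    (fun ψ => hb' ψ (Finset.mem_univ ψ)) w, zero_mul]

theorem _root_.AddChar.sum_smul_eq_zero_of_coprime [Fintype V] {n : ℕ} (hn : n ≠ 0)
    (hV : ∀ v : V, n • v = 0) (χ : AddChar V ℂ) (D : V → ℤ) (h : ∑ v, (D v : ℂ) * χ v = 0)
    {m : ℕ} (hm : m.Coprime n) : ∑ v, (D v : ℂ) * χ (m • v) = 0 := by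
  have hζ := Complex.isPrimitiveRoot_exp n hn
  set ζ := Complex.exp (2 * Real.pi * Complex.I / n)
  have : NeZero n := ⟨hn⟩
  have hk : ∀ v, ∃ k : ℕ, ζ ^ k = χ v := fun v => by
    obtain ⟨k, -, hk⟩ := hζ.eq_pow_of_pow_eq_one (ξ := χ v)
      (by rw [← AddChar.map_nsmul_eq_pow, hV, AddChar.map_zero_eq_one])
    exact ⟨k, hk⟩
  choose k hk using hk
  let P : Polynomial ℤ := ∑ v, Polynomial.monomial (k v) (D v)
  have hP : ∀ z : ℂ, Polynomial.aeval z P = ∑ v, (D v : ℂ) * z ^ k v := fun z => by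
    simp [P, Polynomial.aeval_monomial]
  have hdvd : minpoly ℤ ζ ∣ P := by
    refine minpoly.isIntegrallyClosed_dvd (hζ.isIntegral (Nat.pos_of_ne_zero hn)) ?_
    rw [hP]
    simpa only [hk] using h
  rw [hζ.minpoly_eq_pow_coprime hm] at hdvd
  have := Polynomial.aeval_eq_zero_of_dvd_aeval_eq_zero hdvd (minpoly.aeval ℤ _)
  rw [hP] at this
  simp_rw [AddChar.map_nsmul_eq_pow, ← hk, ← pow_mul]
  simpa only [← pow_mul, mul_comm] using this

end AlgMatch

theorem AddChar.exists_ne_one_zmod (q : ℕ) [Fact q.Prime] : ∃ χ : AddChar (ZMod q) ℂ, χ ≠ 1 := by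
  obtain ⟨χ, hχ⟩ := AddChar.exists_apply_ne_zero.2 (one_ne_zero : (1 : ZMod q) ≠ 0)
  exact ⟨χ, by rintro rfl; simp at hχ⟩

namespace AddChar

variable {q : ℕ} [Fact q.Prime]

theorem exists_mulShift_eq {χ : AddChar (ZMod q) ℂ} (hχ : χ ≠ 1) (φ : AddChar (ZMod q) ℂ) :
    ∃ k, mulShift χ k = φ :=
  ((Fintype.bijective_iff_injective_and_card _).2
    ⟨to_mulShift_inj_of_isPrimitive (IsPrimitive.of_ne_one hχ), AddChar.card_eq.symm⟩).2 φ

/-- Colourings of a group of prime order whose colour classes have the same sums against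
two nontrivial characters agree up to multiplication. -/
theorem exists_mul_of_sum_eq {κ : Type*} {g g' : ZMod q → κ} {χ ψ : AddChar (ZMod q) ℂ}
    (hχ : χ ≠ 1) (hψ : ψ ≠ 1)
    (hs : ∀ a : κ → ℂ, ∑ v, a (g v) * χ v = ∑ v, a (g' v) * ψ v)
    (hc : ∀ a : κ → ℂ, ∑ v, a (g v) = ∑ v, a (g' v)) :
    ∃ k : ZMod q, k ≠ 0 ∧ (∀ v, ψ (k * v) = χ v) ∧ ∀ v, g' (k * v) = g v := by
  classical
  obtain ⟨k, rfl⟩ := exists_mulShift_eq hψ χ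
  have hk : k ≠ 0 := by
    rintro rfl
    exact hχ (mulShift_zero ψ)
  refine ⟨k, hk, fun v => rfl, fun v₀ => ?_⟩
  have hbij : ∀ F : ZMod q → ℂ, ∑ v, F (k * v) = ∑ v, F v := fun F =>
    Fintype.sum_equiv (Equiv.mulLeft₀ k hk) _ _ fun v => rfl
  let D : ZMod q → ℤ := fun v => (if g v = g v₀ then 1 else 0) -
    if g' (k * v) = g v₀ then 1 else 0
  have hD : ∑ v, (D v : ℂ) * mulShift ψ k v = 0 := by
    have h := hs fun i => if i = g v₀ then 1 else 0
    rw [← hbij fun v => (if g' v = g v₀ then (1 : ℂ) else 0) * ψ v] at h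
    simp only [D, Int.cast_sub, Int.cast_ite, Int.cast_one, Int.cast_zero, sub_mul,
      Finset.sum_sub_distrib]
    exact sub_eq_zero.2 h
  have hD0 : ∑ v, (D v : ℂ) = 0 := by
    have h := hc fun i => if i = g v₀ then 1 else 0
    rw [← hbij fun v => (if g' v = g v₀ then (1 : ℂ) else 0)] at h
    simp only [D, Int.cast_sub, Int.cast_ite, Int.cast_one, Int.cast_zero,
      Finset.sum_sub_distrib]
    exact sub_eq_zero.2 h
  have hD1 := AddChar.eq_zero_of_forall_sum_mul_eq_zero (fun v => (D v : ℂ)) (fun φ => by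
    obtain ⟨j, rfl⟩ := exists_mulShift_eq hχ φ
    by_cases hj : j = 0
    · simpa [hj] using hD0
    · have h := AddChar.sum_smul_eq_zero_of_coprime (Fact.out : q.Prime).ne_zero
        (fun v : ZMod q => by simp) _ D hD (m := j.val)
        (ZMod.val_coe_unit_coprime (Units.mk0 j hj))
      simpa [nsmul_eq_mul] using h) v₀
  by_contra hne
  simp [D, hne] at hD1

end AddChar

namespace AlgMatch

variable {V W κ : Type*} [AddCommGroup V] [AddCommGroup W] {c : V → κ} {c' : W → κ}

theorem sum_eq [Fintype V] [Fintype W] (M : AlgMatch c c') (a : κ → ℂ) :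
    ∑ v, a (c v) = ∑ w, a (c' w) := by
  obtain ⟨e, he⟩ := M.exists_equiv 0 0 M.zero.symm
  exact Fintype.sum_equiv e _ _ fun v => by rw [(he v).1]

theorem _root_.AddChar.ne_one_of_sum_eq [Fintype V] [Fintype W] {χ : AddChar V ℂ}
    {ψ : AddChar W ℂ} (h : ∑ v, χ v = ∑ w, ψ w) (hχ : χ ≠ 1) : ψ ≠ 1 := by
  intro hψ
  rw [AddChar.sum_eq_zero_iff_ne_zero.2 hχ] at h
  exact AddChar.sum_eq_zero_iff_ne_zero.1 h.symm hψ

theorem realizable_zmod {q : ℕ} [Fact q.Prime] {c c' : ZMod q → κ} (M : AlgMatch c c') :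
    Realizable c c' := by
  obtain ⟨χ, hχ⟩ := AddChar.exists_ne_one_zmod q
  obtain ⟨ψ, hψ⟩ := M.exists_addChar χ
  obtain ⟨k, -, -, hk⟩ := AddChar.exists_mul_of_sum_eq hχ (AddChar.ne_one_of_sum_eq (by simpa using hψ 1) hχ) hψ M.sum_eq
  exact ⟨fun v => k * v, fun g h => by rw [← mul_sub, hk]⟩

/-- Modulo a prime `q`, summation over `q`-th parts preserves colour-invariant functions. -/
theorem sum_smul_eq [Fintype V] [DecidableEq V] (M : AlgMatch c c) {q : ℕ}
    [Fact q.Prime] (a : κ → ZMod q) {v v' : V} (h : c v = c v') :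
    (∑ x, if q • x = v then a (c x) else 0) = ∑ x, if q • x = v' then a (c x) else 0 := by
  have : CharP (AddMonoidAlgebra (ZMod q) V) q :=
    charP_of_injective_algebraMap (algebraMap (ZMod q) _).injective q
  let F : (V → ZMod q) → AddMonoidAlgebra (ZMod q) V := fun f =>
    ∑ x, AddMonoidAlgebra.single x (f x)
  have hmul : ∀ f g, F f * F g = F fun v => ∑ x, f x * g (v - x) := by
    intro f g
    simp only [F, Finset.sum_mul_sum, AddMonoidAlgebra.single_mul_single]
    simp_rw [← AddMonoidAlgebra.singleAddHom_apply, map_sum]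
    rw [Finset.sum_comm (f := fun v x => AddMonoidAlgebra.singleAddHom v (f x * g (v - x)))]
    exact Finset.sum_congr rfl fun x _ =>
      Fintype.sum_equiv (Equiv.addLeft x) _ _ fun y => by simp
  have hcoeff : ∀ f v, (F f).coeff v = f v := by
    intro f v
    simp [F, AddMonoidAlgebra.coeff_sum, Finsupp.single_apply]
  have hpow : ∀ m : ℕ, ∃ d : κ → ZMod q, F (fun v => a (c v)) ^ (m + 1) = F fun v => d (c v) := by
    intro m
    induction m with
    | zero => exact ⟨a, by simp⟩
    | succ m ih =>
      obtain ⟨b, hb⟩ := ih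
      obtain ⟨d, hd, -⟩ := M.exists_conv b a
      refine ⟨d, ?_⟩
      rw [pow_succ, hb, hmul]
      simp_rw [hd]
  obtain ⟨d, hd⟩ := hpow (q - 1)
  rw [Nat.sub_add_cancel (Fact.out : q.Prime).one_le, sum_pow_char] at hd
  simp only [AddMonoidAlgebra.single_pow, ZMod.pow_card] at hd
  have hv : ∀ v, (∑ x, if q • x = v then a (c x) else 0) = d (c v) := by
    intro v
    rw [← hcoeff (fun v => d (c v)) v, ← hd]
    simp [AddMonoidAlgebra.coeff_sum, Finsupp.single_apply]
  rw [hv, hv, h]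

end AlgMatch

/-- The kernel of the first projection is a union of colour classes. -/
def FstSaturated {A B κ : Type*} [Zero A] (c : A × B → κ) : Prop :=
  ∀ v v', c v = c v' → v.1 = 0 → v'.1 = 0

namespace AlgMatch

variable {κ : Type*} {q r : ℕ} [Fact q.Prime] [Fact r.Prime] {c c' : ZMod q × ZMod r → κ}

theorem natCast_ne_zero_of_ne (hqr : q ≠ r) : (q : ZMod r) ≠ 0 := by
  rw [Ne, ZMod.natCast_eq_zero_iff, Nat.prime_dvd_prime_iff_eq Fact.out Fact.out]
  exact hqr.symm

theorem color_eq_of_not_fstSaturated (hqr : q ≠ r) (M : AlgMatch c c) (h : ¬ FstSaturated c)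
    (a a' : ZMod q) {b : ZMod r} (hb : b ≠ 0) : c (a', b) = c (a, b) := by
  classical
  let S : AddSubgroup (ZMod r) :=
    { carrier := {b | ∀ v, c v = c (0, b) → v.1 = 0}
      zero_mem' := fun v hv => by rw [M.eq_zero v hv]; rfl
      add_mem' := fun {b b'} hb hb' v hv => by
        obtain ⟨x, y, rfl, hx, hy⟩ := M.exists_add (x := (0, b)) (y := (0, b')) (by simpa using hv)
        rw [Prod.fst_add, hb x hx, hb' y hy, add_zero]
      neg_mem' := fun {b} hb v hv => by
        have := hb (-v) (by simpa using M.color_neg hv)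
        simpa using this }
  have : Fact (Nat.card (ZMod r)).Prime := by rwa [Nat.card_zmod]
  rcases S.eq_bot_or_eq_top_of_prime_card with hS | hS
  · have hqb : (q : ZMod r) * b ∉ S := by
      rw [hS, AddSubgroup.mem_bot]
      exact mul_ne_zero (natCast_ne_zero_of_ne hqr) hb
    obtain ⟨v, hv, hv1⟩ : ∃ v, c v = c (0, (q : ZMod r) * b) ∧ v.1 ≠ 0 := by
      have : ¬ ∀ v, c v = c (0, (q : ZMod r) * b) → v.1 = 0 := hqb
      push Not at this
      exact this
    have hsum := M.sum_smul_eq (q := q) (fun k => if k = c (a, b) then 1 else 0) hv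
    rw [Finset.sum_eq_zero fun x _ => if_neg fun hx => hv1 (by simp [← hx])] at hsum
    have hx : ∀ x : ZMod q × ZMod r, q • x = (0, (q : ZMod r) * b) ↔ x.2 = b := fun x => by
      simp [Prod.ext_iff, natCast_ne_zero_of_ne hqr]
    simp_rw [hx] at hsum
    rw [Fintype.sum_prod_type] at hsum
    simp only [Finset.sum_ite_eq', Finset.mem_univ, if_true] at hsum
    rw [Finset.sum_boole, eq_comm, ZMod.natCast_eq_zero_iff] at hsum
    have hle := Nat.le_of_dvd (Finset.card_pos.2 ⟨a, by simp⟩) hsum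
    have huniv := Finset.eq_univ_of_card _ (le_antisymm (Finset.card_le_univ _)
      ((ZMod.card q).trans_le hle))
    have ha' := Finset.mem_univ a'
    rw [← huniv] at ha'
    simpa using ha'
  · refine absurd (fun v v' hv hv1 => ?_) h
    have : v.2 ∈ S := hS ▸ AddSubgroup.mem_top _
    refine this v' ?_
    rw [← hv]
    congr 1
    exact Prod.ext hv1 rfl

theorem fst_eq_zero_iff (hqr : q ≠ r) (M : AlgMatch c c') (h : FstSaturated c)
    {v w : ZMod q × ZMod r} (hvw : c v = c' w) : v.1 = 0 ↔ w.1 = 0 := by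
  let K : AddSubgroup (ZMod q × ZMod r) :=
    { carrier := {w | ∃ v, v.1 = 0 ∧ c v = c' w}
      zero_mem' := ⟨0, rfl, M.zero.symm⟩
      add_mem' := by
        rintro w w' ⟨v, hv, hvw⟩ ⟨v', hv', hvw'⟩
        obtain ⟨u, hu⟩ := M.symm.exists_color (w + w')
        obtain ⟨x, y, rfl, hx, hy⟩ := M.symm.exists_add hu
        refine ⟨x + y, ?_, hu⟩
        rw [Prod.fst_add, h v x (hvw.trans hx.symm) hv, h v' y (hvw'.trans hy.symm) hv', add_zero]
      neg_mem' := by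
        rintro w ⟨v, hv, hvw⟩
        exact ⟨-v, by simp [hv], M.symm.color_neg hvw⟩ }
  obtain ⟨e, he⟩ := M.exists_equiv 0 0 M.zero.symm
  have heK : ∀ v : ZMod q × ZMod r, v.1 = 0 ↔ e v ∈ K := fun v =>
    ⟨fun hv => ⟨v, hv, (he v).1.symm⟩, fun ⟨u, hu, hue⟩ => h u v (hue.trans (he v).1) hu⟩
  have hcard : Nat.card K = r := by
    rw [← Nat.card_congr (e.subtypeEquiv heK)]
    refine Eq.trans (Nat.card_congr ?_) (Nat.card_zmod r)
    exact ⟨fun v => v.1.2, fun b => ⟨(0, b), rfl⟩,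
      fun v => Subtype.ext (Prod.ext v.2.symm rfl), fun b => rfl⟩
  have hK : ∀ w ∈ K, w.1 = 0 := by
    intro w hw
    have h1 : (r • (⟨w, hw⟩ : K)) = 0 := by
      have h0 := card_nsmul_eq_zero' (x := (⟨w, hw⟩ : K))
      rwa [hcard] at h0
    have h2 : (r : ZMod q) * w.1 = 0 := by
      have := congrArg (fun x : K => x.1.1) h1
      simpa using this
    exact (mul_eq_zero.1 h2).resolve_left (natCast_ne_zero_of_ne hqr.symm)
  have hinj : Function.Bijective fun v : {v : ZMod q × ZMod r // v.1 = 0} =>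
      (⟨e v.1, hK _ ((heK _).1 v.2)⟩ : {v : ZMod q × ZMod r // v.1 = 0}) :=
    Finite.injective_iff_bijective.1 fun x y hxy =>
      Subtype.ext (e.injective (congrArg Subtype.val hxy))
  refine ⟨fun hv => hK w ⟨v, hv, hvw⟩, fun hw => ?_⟩
  obtain ⟨u, hu⟩ := hinj.2 ⟨w, hw⟩
  have hu' : e u.1 = w := congrArg Subtype.val hu
  refine h u.1 v ?_ u.2
  rw [hvw, ← hu', (he _).1]

theorem comp_swap {A B : Type*} [AddCommGroup A] [AddCommGroup B] {c c' : A × B → κ}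
    (M : AlgMatch c c') : AlgMatch (fun v : B × A => c v.swap) fun v : B × A => c' v.swap :=
  (M.comp_left AddEquiv.prodComm).comp_right AddEquiv.prodComm

theorem realizable_of_not_fstSaturated (hqr : q ≠ r) (M : AlgMatch c c') (h : ¬ FstSaturated c)
    (h' : ¬ FstSaturated fun v : ZMod r × ZMod q => c v.swap) : Realizable c c' := by
  have h1 : ∀ v, v ≠ 0 → c v = c (1, 1) := by
    have hT : ∀ (a a' : ZMod q) {b : ZMod r}, b ≠ 0 → c (a', b) = c (a, b) := fun a a' _ hb =>
      color_eq_of_not_fstSaturated hqr M.self h a a' hb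
    have hP : ∀ (b b' : ZMod r) {a : ZMod q}, a ≠ 0 → c (a, b') = c (a, b) := fun b b' _ ha =>
      color_eq_of_not_fstSaturated hqr.symm M.self.comp_swap h' b b' ha
    rintro ⟨a, b⟩ hv
    by_cases ha : a = 0
    · rw [hT 1 a fun hb => hv (by rw [ha, hb]; rfl), hP 1 b one_ne_zero]
    · rw [hP 1 b ha, hT 1 a one_ne_zero]
  refine ⟨id, fun g k => ?_⟩
  obtain ⟨v, hv⟩ := M.symm.exists_color (k - g)
  rw [id, id, ← hv]
  have := M.eq_zero_iff hv.symm
  by_cases h0 : v = 0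
  · rw [this.2 h0, h0]
  · rw [h1 v h0, h1 (k - g) fun h => h0 (this.1 h)]

end AlgMatch

theorem AddChar.apply_prod {A B : Type*} [AddCommGroup A] [AddCommGroup B]
    (φ : AddChar (A × B) ℂ) (a : A) (b : B) : φ (a, b) = φ (a, 0) * φ (0, b) := by
  rw [← AddChar.map_add_eq_mul, Prod.mk_add_mk, add_zero, zero_add]

namespace AlgMatch

variable {κ : Type*} {q r : ℕ} [Fact q.Prime] [Fact r.Prime] {c c' : ZMod q × ZMod r → κ}

theorem fstSaturated_right (hqr : q ≠ r) (M : AlgMatch c c') (h : FstSaturated c) :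
    FstSaturated c' := by
  intro w w' hw hw1
  obtain ⟨v, hv⟩ := M.symm.exists_color w
  rw [← M.fst_eq_zero_iff hqr h (hv.trans hw), M.fst_eq_zero_iff hqr h hv]
  exact hw1

/-- Matched sums against characters restrict to the kernel of the first projection. -/
theorem sum_inr_eq (hqr : q ≠ r) (M : AlgMatch c c') (h : FstSaturated c)
    {χ ψ : ZMod q × ZMod r → ℂ} (hs : ∀ a : κ → ℂ, ∑ v, a (c v) * χ v = ∑ w, a (c' w) * ψ w)
    (a : κ → ℂ) : ∑ b, a (c (0, b)) * χ (0, b) = ∑ b, a (c' (0, b)) * ψ (0, b) := by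
  classical
  have h1 := hs fun k => if ∃ u, u.1 = 0 ∧ c u = k then a k else 0
  have h2 : ∀ v, (∃ u, u.1 = 0 ∧ c u = c v) ↔ v.1 = 0 := fun v =>
    ⟨fun ⟨u, hu, huv⟩ => h u v huv hu, fun hv => ⟨v, hv, rfl⟩⟩
  have h3 : ∀ w, (∃ u, u.1 = 0 ∧ c u = c' w) ↔ w.1 = 0 := fun w => by
    refine ⟨fun ⟨u, hu, huv⟩ => (M.fst_eq_zero_iff hqr h huv).1 hu, fun hw => ?_⟩
    obtain ⟨u, hu⟩ := M.symm.exists_color w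
    exact ⟨u, (M.fst_eq_zero_iff hqr h hu).2 hw, hu⟩
  simp_rw [h2, h3, Fintype.sum_prod_type_right, ite_mul, zero_mul] at h1
  simpa only [Finset.sum_ite_eq', Finset.sum_ite_eq, Finset.mem_univ, if_true] using h1

theorem sum_inl_eq (hqr : q ≠ r) (M : AlgMatch c c')
    (h : FstSaturated fun v : ZMod r × ZMod q => c v.swap)
    {χ ψ : ZMod q × ZMod r → ℂ} (hs : ∀ a : κ → ℂ, ∑ v, a (c v) * χ v = ∑ w, a (c' w) * ψ w)
    (b : κ → ℂ) : ∑ a, b (c (a, 0)) * χ (a, 0) = ∑ a, b (c' (a, 0)) * ψ (a, 0) :=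
  M.comp_swap.sum_inr_eq hqr.symm h (χ := fun v => χ v.swap) (ψ := fun v => ψ v.swap)
    (fun a => by
      rw [← (Equiv.prodComm (ZMod q) (ZMod r)).sum_comp, ← (Equiv.prodComm (ZMod q) (ZMod r)).sum_comp]
      exact hs a)
    b

/-- A colouring is determined up to multiplication on the kernel of the first projection. -/
theorem exists_mul_inr (hqr : q ≠ r) (M : AlgMatch c c') (h : FstSaturated c)
    {χ ψ : AddChar (ZMod q × ZMod r) ℂ}
    (hs : ∀ a : κ → ℂ, ∑ v, a (c v) * χ v = ∑ w, a (c' w) * ψ w)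
    (hχ : χ.compAddMonoidHom (AddMonoidHom.inr _ _) ≠ 1) :
    ∃ l : ZMod r, l ≠ 0 ∧ (∀ b, ψ (0, l * b) = χ (0, b)) ∧ ∀ b, c' (0, l * b) = c (0, b) := by
  have h1 := M.sum_inr_eq hqr h hs
  refine AddChar.exists_mul_of_sum_eq (g := fun b => c (0, b)) (g' := fun b => c' (0, b)) hχ
    (AddChar.ne_one_of_sum_eq ?_ hχ :
      ψ.compAddMonoidHom (AddMonoidHom.inr (ZMod q) (ZMod r)) ≠ 1) h1 fun a => ?_
  · simpa using h1 1
  · simpa using M.sum_inr_eq hqr h (χ := 1) (ψ := 1) (by simpa using M.sum_eq) a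

theorem exists_mul_inl (hqr : q ≠ r) (M : AlgMatch c c')
    (h : FstSaturated fun v : ZMod r × ZMod q => c v.swap)
    {χ ψ : AddChar (ZMod q × ZMod r) ℂ}
    (hs : ∀ a : κ → ℂ, ∑ v, a (c v) * χ v = ∑ w, a (c' w) * ψ w)
    (hχ : χ.compAddMonoidHom (AddMonoidHom.inl _ _) ≠ 1) :
    ∃ k : ZMod q, k ≠ 0 ∧ (∀ a, ψ (k * a, 0) = χ (a, 0)) ∧ ∀ a, c' (k * a, 0) = c (a, 0) := by
  have h1 := M.sum_inl_eq hqr h hs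
  refine AddChar.exists_mul_of_sum_eq (g := fun a => c (a, 0)) (g' := fun a => c' (a, 0)) hχ
    (AddChar.ne_one_of_sum_eq ?_ hχ :
      ψ.compAddMonoidHom (AddMonoidHom.inl (ZMod q) (ZMod r)) ≠ 1) h1 fun a => ?_
  · simpa using h1 1
  · simpa using M.sum_inl_eq hqr h (χ := 1) (ψ := 1) (by simpa using M.sum_eq) a

theorem realizable_of_fstSaturated_of_not (hqr : q ≠ r) (M : AlgMatch c c') (h : FstSaturated c)
    (h' : ¬ FstSaturated fun v : ZMod r × ZMod q => c v.swap) : Realizable c c' := by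
  classical
  have hm {v w} (hvw : c v = c' w) := M.fst_eq_zero_iff hqr h hvw
  have hP : ∀ {a : ZMod q} (b : ZMod r), a ≠ 0 → c (a, b) = c (a, 0) := fun b ha =>
    color_eq_of_not_fstSaturated hqr.symm M.self.comp_swap h' 0 b ha
  have hP' : ∀ {a : ZMod q} (b : ZMod r), a ≠ 0 → c' (a, b) = c' (a, 0) := fun b ha =>
    color_eq_of_not_fstSaturated hqr.symm M.symm.self.comp_swap
      (fun hsat => h' (M.symm.comp_swap.fstSaturated_right hqr.symm hsat)) 0 b ha
  obtain ⟨χq, hχq⟩ := AddChar.exists_ne_one_zmod q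
  obtain ⟨χr, hχr⟩ := AddChar.exists_ne_one_zmod r
  obtain ⟨ψ, hψ⟩ := M.exists_addChar (χq.compAddMonoidHom (AddMonoidHom.fst _ (ZMod r)))
  obtain ⟨ψ', hψ'⟩ := M.exists_addChar (χr.compAddMonoidHom (AddMonoidHom.snd (ZMod q) _))
  obtain ⟨l, hl, -, hlc⟩ := M.exists_mul_inr hqr h hψ' hχr
  have hψ0 : ∀ b, ψ (0, b) = 1 := by
    have h1 : ψ.compAddMonoidHom (AddMonoidHom.inr (ZMod q) (ZMod r)) = 1 := by
      by_contra hne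
      refine AddChar.ne_one_of_sum_eq (ψ := (1 : AddChar (ZMod r) ℂ)) ?_ hne rfl
      have := M.sum_inr_eq hqr h hψ 1
      simpa using this.symm
    exact fun b => DFunLike.congr_fun h1 b
  let m : κ → κ := fun k => if ∃ u, u.1 = 0 ∧ c u = k then c 0 else k
  have hmc : ∀ v, m (c v) = if v.1 = 0 then c 0 else c v := fun v =>
    if_congr ⟨fun ⟨u, hu, huv⟩ => h u v huv hu, fun hv => ⟨v, hv, rfl⟩⟩ rfl rfl
  have hmc' : ∀ w, m (c' w) = if w.1 = 0 then c 0 else c' w := fun w => by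
    refine if_congr ⟨fun ⟨u, hu, huv⟩ => (hm huv).1 hu, fun hw => ?_⟩ rfl rfl
    obtain ⟨u, hu⟩ := M.symm.exists_color w
    exact ⟨u, (hm hu).2 hw, hu⟩
  have hg : ∀ a b, m (c (a, b)) = m (c (a, 0)) := fun a b => by
    simp only [hmc]
    split_ifs with ha
    · rfl
    · exact hP b ha
  have hg' : ∀ a b, m (c' (a, b)) = m (c' (a, 0)) := fun a b => by
    simp only [hmc']
    split_ifs with ha
    · rfl
    · exact hP' b ha
  have hr : (r : ℂ) ≠ 0 := Nat.cast_ne_zero.2 (Fact.out : r.Prime).ne_zero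
  have hs : ∀ F : κ → ℂ, ∑ a, F (m (c (a, 0))) * χq a = ∑ a, F (m (c' (a, 0))) * ψ (a, 0) := by
    intro F
    have h1 := hψ fun k => F (m k)
    have h2 : ∀ a b, F (m (c (a, b))) *
        χq.compAddMonoidHom (AddMonoidHom.fst (ZMod q) (ZMod r)) (a, b) =
        F (m (c (a, 0))) * χq a := fun a b => by rw [hg]; rfl
    have h3 : ∀ a b, F (m (c' (a, b))) * ψ (a, b) = F (m (c' (a, 0))) * ψ (a, 0) := fun a b => by
      rw [hg', ψ.apply_prod, hψ0, mul_one]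
    rw [Fintype.sum_prod_type, Fintype.sum_prod_type,
      Finset.sum_congr rfl fun a _ => Finset.sum_congr rfl fun b _ => h2 a b,
      Finset.sum_congr rfl fun a _ => Finset.sum_congr rfl fun b _ => h3 a b] at h1
    simpa [← Finset.mul_sum, hr] using h1
  have hc : ∀ F : κ → ℂ, ∑ a, F (m (c (a, 0))) = ∑ a, F (m (c' (a, 0))) := by
    intro F
    have h1 := M.sum_eq fun k => F (m k)
    rw [Fintype.sum_prod_type, Fintype.sum_prod_type,
      Finset.sum_congr rfl fun a _ => Finset.sum_congr rfl fun b _ => congrArg F (hg a b),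
      Finset.sum_congr rfl fun a _ => Finset.sum_congr rfl fun b _ => congrArg F (hg' a b)] at h1
    simpa [← Finset.mul_sum, hr] using h1
  obtain ⟨k, hk, -, hkc⟩ := AddChar.exists_mul_of_sum_eq (g := fun a => m (c (a, 0)))
    (g' := fun a => m (c' (a, 0))) hχq (AddChar.ne_one_of_sum_eq (by simpa using hs 1) hχq :
      ψ.compAddMonoidHom (AddMonoidHom.inl (ZMod q) (ZMod r)) ≠ 1) hs hc
  have hf : ∀ a b, c' (k * a, l * b) = c (a, b) := by
    intro a b
    by_cases ha : a = 0
    · simpa [ha] using hlc b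
    · have hka := mul_ne_zero hk ha
      have := hkc a
      rw [hmc, hmc', if_neg ha, if_neg hka] at this
      rw [hP b ha, hP' _ hka, this]
  refine ⟨fun v => (k * v.1, l * v.2), fun g v => ?_⟩
  rw [Prod.mk_sub_mk, ← mul_sub, ← mul_sub]
  exact hf _ _

theorem sum_fst_fiber_eq (hqr : q ≠ r) (M : AlgMatch c c') (h : FstSaturated c) {a : ZMod q}
    (ha : c' (a, 0) = c (a, 0)) (F : κ → ℂ) : ∑ b, F (c (a, b)) = ∑ b, F (c' (a, b)) := by
  obtain ⟨e, he⟩ := M.exists_equiv (a, 0) (a, 0) ha.symm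
  have h1 : ∀ v, v.1 = a ↔ (e v).1 = a := fun v => by
    have : a - v.1 = 0 ↔ a - (e v).1 = 0 := M.fst_eq_zero_iff hqr h (he v).2.symm
    rw [sub_eq_zero, sub_eq_zero] at this
    rw [eq_comm, this, eq_comm]
  have h2 : ∑ v : ZMod q × ZMod r, (if v.1 = a then F (c v) else 0) =
      ∑ v : ZMod q × ZMod r, if v.1 = a then F (c' v) else 0 :=
    Fintype.sum_equiv e _ _ fun v => by simp only [h1 v, (he v).1]
  simpa [Fintype.sum_prod_type_right] using h2

theorem sum_snd_fiber_eq (hqr : q ≠ r) (M : AlgMatch c c')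
    (h : FstSaturated fun v : ZMod r × ZMod q => c v.swap) {b : ZMod r}
    (hb : c' (0, b) = c (0, b)) (F : κ → ℂ) : ∑ a, F (c (a, b)) = ∑ a, F (c' (a, b)) :=
  M.comp_swap.sum_fst_fiber_eq hqr.symm h hb F

theorem _root_.AddChar.exists_nsmul_eq (hqr : q ≠ r) {χ φ : AddChar (ZMod q × ZMod r) ℂ}
    (hχ : χ.compAddMonoidHom (AddMonoidHom.inl _ _) ≠ 1)
    (hχ' : χ.compAddMonoidHom (AddMonoidHom.inr _ _) ≠ 1)
    (hφ : φ.compAddMonoidHom (AddMonoidHom.inl _ _) ≠ 1)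
    (hφ' : φ.compAddMonoidHom (AddMonoidHom.inr _ _) ≠ 1) :
    ∃ m : ℕ, m.Coprime (q * r) ∧ ∀ v, φ v = χ (m • v) := by
  obtain ⟨j, hj⟩ := AddChar.exists_mulShift_eq hχ (φ.compAddMonoidHom (AddMonoidHom.inl _ _))
  obtain ⟨l, hl⟩ := AddChar.exists_mulShift_eq hχ' (φ.compAddMonoidHom (AddMonoidHom.inr _ _))
  have hj0 : j ≠ 0 := by
    rintro rfl
    exact hφ (by rw [← hj, AddChar.mulShift_zero])
  have hl0 : l ≠ 0 := by
    rintro rfl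
    exact hφ' (by rw [← hl, AddChar.mulShift_zero])
  obtain ⟨m, hmj, hml⟩ := Nat.chineseRemainder
    ((Nat.coprime_primes (Fact.out : q.Prime) (Fact.out : r.Prime)).2 hqr) j.val l.val
  have hmj' : (m : ZMod q) = j := by
    rw [(ZMod.natCast_eq_natCast_iff _ _ _).2 hmj, ZMod.natCast_zmod_val]
  have hml' : (m : ZMod r) = l := by
    rw [(ZMod.natCast_eq_natCast_iff _ _ _).2 hml, ZMod.natCast_zmod_val]
  refine ⟨m, Nat.Coprime.mul_right ?_ ?_, fun ⟨a, b⟩ => ?_⟩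
  · exact (ZMod.isUnit_iff_coprime m q).1 (hmj' ▸ isUnit_iff_ne_zero.2 hj0)
  · exact (ZMod.isUnit_iff_coprime m r).1 (hml' ▸ isUnit_iff_ne_zero.2 hl0)
  · rw [Prod.smul_mk, χ.apply_prod, φ.apply_prod, nsmul_eq_mul, nsmul_eq_mul, hmj', hml']
    exact congrArg₂ _ (DFunLike.congr_fun hj a).symm (DFunLike.congr_fun hl b).symm

theorem eq_of_sum_eq (hqr : q ≠ r) (M : AlgMatch c c') (h : FstSaturated c)
    (h' : FstSaturated fun v : ZMod r × ZMod q => c v.swap) {χ : AddChar (ZMod q × ZMod r) ℂ}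
    (hχ : χ.compAddMonoidHom (AddMonoidHom.inl _ _) ≠ 1)
    (hχ' : χ.compAddMonoidHom (AddMonoidHom.inr _ _) ≠ 1)
    (hs : ∀ a : κ → ℂ, ∑ v, a (c v) * χ v = ∑ w, a (c' w) * χ w)
    (hl : ∀ a, c' (a, 0) = c (a, 0)) (hr : ∀ b, c' (0, b) = c (0, b))
    (v₀ : ZMod q × ZMod r) : c' v₀ = c v₀ := by
  classical
  let D : ZMod q × ZMod r → ℤ := fun v => (if c v = c v₀ then 1 else 0) -
    if c' v = c v₀ then 1 else 0
  have hD : ∑ v, (D v : ℂ) * χ v = 0 := by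
    simp only [D, Int.cast_sub, Int.cast_ite, Int.cast_one, Int.cast_zero, sub_mul,
      Finset.sum_sub_distrib]
    exact sub_eq_zero.2 (hs fun i => if i = c v₀ then 1 else 0)
  have hfst : ∀ a, ∑ b, (D (a, b) : ℂ) = 0 := fun a => by
    simp only [D, Int.cast_sub, Int.cast_ite, Int.cast_one, Int.cast_zero,
      Finset.sum_sub_distrib]
    exact sub_eq_zero.2 (M.sum_fst_fiber_eq hqr h (hl a) fun i => if i = c v₀ then 1 else 0)
  have hsnd : ∀ b, ∑ a, (D (a, b) : ℂ) = 0 := fun b => by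
    simp only [D, Int.cast_sub, Int.cast_ite, Int.cast_one, Int.cast_zero,
      Finset.sum_sub_distrib]
    exact sub_eq_zero.2 (M.sum_snd_fiber_eq hqr h' (hr b) fun i => if i = c v₀ then 1 else 0)
  have hD1 := AddChar.eq_zero_of_forall_sum_mul_eq_zero (fun v => (D v : ℂ)) (fun φ => by
    by_cases h1 : φ.compAddMonoidHom (AddMonoidHom.inl (ZMod q) (ZMod r)) = 1
    · rw [Fintype.sum_prod_type_right]
      refine Finset.sum_eq_zero fun b _ => ?_
      have h2 : ∀ a, (D (a, b) : ℂ) * φ (a, b) = D (a, b) * φ (0, b) := fun a => by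
        have h3 : φ (a, 0) = 1 := DFunLike.congr_fun h1 a
        rw [φ.apply_prod, h3, one_mul]
      simp_rw [h2]
      rw [← Finset.sum_mul, hsnd, zero_mul]
    by_cases h2 : φ.compAddMonoidHom (AddMonoidHom.inr (ZMod q) (ZMod r)) = 1
    · rw [Fintype.sum_prod_type]
      refine Finset.sum_eq_zero fun a _ => ?_
      have h3 : ∀ b, (D (a, b) : ℂ) * φ (a, b) = D (a, b) * φ (a, 0) := fun b => by
        have h4 : φ (0, b) = 1 := DFunLike.congr_fun h2 b
        rw [φ.apply_prod, h4, mul_one]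
      simp_rw [h3]
      rw [← Finset.sum_mul, hfst, zero_mul]
    obtain ⟨m, hm, hφ⟩ := AddChar.exists_nsmul_eq hqr hχ hχ' h1 h2
    simp_rw [hφ]
    refine AddChar.sum_smul_eq_zero_of_coprime (n := q * r) ?_ (fun v => ?_) χ D hD hm
    · exact mul_ne_zero (Fact.out : q.Prime).ne_zero (Fact.out : r.Prime).ne_zero
    · ext <;> simp) v₀
  by_contra hne
  simp [D, hne] at hD1

theorem realizable_of_fstSaturated (hqr : q ≠ r) (M : AlgMatch c c') (h : FstSaturated c)
    (h' : FstSaturated fun v : ZMod r × ZMod q => c v.swap) : Realizable c c' := by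
  obtain ⟨χq, hχq⟩ := AddChar.exists_ne_one_zmod q
  obtain ⟨χr, hχr⟩ := AddChar.exists_ne_one_zmod r
  let χ : AddChar (ZMod q × ZMod r) ℂ := χq.compAddMonoidHom (AddMonoidHom.fst _ _) *
    χr.compAddMonoidHom (AddMonoidHom.snd _ _)
  have hχ : χ.compAddMonoidHom (AddMonoidHom.inl _ _) ≠ 1 := by
    convert hχq using 1
    ext a
    simp [χ]
  have hχ' : χ.compAddMonoidHom (AddMonoidHom.inr _ _) ≠ 1 := by
    convert hχr using 1
    ext a
    simp [χ]
  obtain ⟨ψ, hψ⟩ := M.exists_addChar χ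
  obtain ⟨k, hk, hkψ, hkc⟩ := M.exists_mul_inl hqr h' hψ hχ
  obtain ⟨l, hl, hlψ, hlc⟩ := M.exists_mul_inr hqr h hψ hχ'
  let φ : ZMod q × ZMod r ≃+ ZMod q × ZMod r :=
    (AddAut.mulLeft (Units.mk0 k hk)).prodCongr (AddAut.mulLeft (Units.mk0 l hl))
  have hφ : ∀ a b, φ (a, b) = (k * a, l * b) := fun a b => rfl
  have hφχ : ∀ v, ψ (φ v) = χ v := fun ⟨a, b⟩ => by
    rw [hφ, ψ.apply_prod, χ.apply_prod, hkψ, hlψ]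
  refine Realizable.of_comp (AddEquiv.refl _) φ ⟨id, fun g v => ?_⟩
  refine (M.comp_right φ).eq_of_sum_eq hqr h h' hχ hχ' (fun a => ?_) (fun a => ?_) (fun b => ?_) _
  · rw [hψ]
    exact (Fintype.sum_equiv φ.toEquiv _ _ fun v => by
      rw [← hφχ]
      rfl).symm
  · simpa [hφ] using hkc a
  · simpa [hφ] using hlc b

theorem realizable_zmod_prod (hqr : q ≠ r) (M : AlgMatch c c') : Realizable c c' := by
  by_cases h : FstSaturated c <;>
    by_cases h' : FstSaturated fun v : ZMod r × ZMod q => c v.swap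
  · exact M.realizable_of_fstSaturated hqr h h'
  · exact M.realizable_of_fstSaturated_of_not hqr h h'
  · exact Realizable.of_comp AddEquiv.prodComm AddEquiv.prodComm
      (M.comp_swap.realizable_of_fstSaturated_of_not hqr.symm h' h)
  · exact M.realizable_of_not_fstSaturated hqr h h'

end AlgMatch

theorem nonempty_zmod_addEquiv {A : Type*} [AddCommGroup A] [IsAddCyclic A] {n : ℕ}
    (h : Nat.card A = n) : Nonempty (ZMod n ≃+ A) := by
  obtain ⟨g, hg⟩ := IsAddCyclic.exists_generator (α := A)
  exact ⟨zmodAddEquivOfGenerator hg h⟩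

namespace AlgMatch

variable {V W κ : Type*} [AddCommGroup V] [AddCommGroup W] {c : V → κ} {c' : W → κ}

theorem realizable_of_card_prime (M : AlgMatch c c') {p : ℕ} (hp : p.Prime)
    (hV : Nat.card V = p) : Realizable c c' := by
  have : Fact p.Prime := ⟨hp⟩
  obtain ⟨e⟩ := M.equiv
  have hW : Nat.card W = p := (Nat.card_congr e).symm.trans hV
  have : IsAddCyclic V := isAddCyclic_of_prime_card hV
  have : IsAddCyclic W := isAddCyclic_of_prime_card hW
  obtain ⟨a⟩ := nonempty_zmod_addEquiv hV
  obtain ⟨b⟩ := nonempty_zmod_addEquiv hW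
  exact Realizable.of_comp a b ((M.comp_left a).comp_right b).realizable_zmod

theorem _root_.nonempty_zmod_prod_addEquiv {q r : ℕ} (hq : q.Prime) (hr : r.Prime) (hqr : q ≠ r)
    (hV : Nat.card V = q * r) : Nonempty (ZMod q × ZMod r ≃+ V) := by
  have hcop := (Nat.coprime_primes hq hr).2 hqr
  have hsq : Squarefree (Nat.card V) := by
    rw [hV, Nat.squarefree_mul hcop]
    exact ⟨hq.prime.squarefree, hr.prime.squarefree⟩
  have : IsAddCyclic V := by
    have : Finite (Multiplicative V) := Nat.finite_of_card_ne_zero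
      (hV.trans_ne (mul_ne_zero hq.ne_zero hr.ne_zero))
    have := IsZGroup.of_squarefree (G := Multiplicative V) hsq
    exact isCyclic_multiplicative_iff.1 inferInstance
  obtain ⟨a⟩ := nonempty_zmod_addEquiv hV
  exact ⟨(ZMod.chineseRemainder hcop).symm.toAddEquiv.trans a⟩

theorem realizable_of_card_mul_prime (M : AlgMatch c c') {q r : ℕ} (hq : q.Prime) (hr : r.Prime)
    (hqr : q ≠ r) (hV : Nat.card V = q * r) : Realizable c c' := by
  have : Fact q.Prime := ⟨hq⟩
  have : Fact r.Prime := ⟨hr⟩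
  obtain ⟨e⟩ := M.equiv
  obtain ⟨a⟩ := nonempty_zmod_prod_addEquiv hq hr hqr hV
  obtain ⟨b⟩ := nonempty_zmod_prod_addEquiv hq hr hqr ((Nat.card_congr e).symm.trans hV)
  exact Realizable.of_comp a b ((M.comp_left a).comp_right b |>.realizable_zmod_prod hqr)

end AlgMatch

/-- For every prime `p`, the groups `E_9` (elementary abelian of order 9), `C_p`, and
`C_{3p}` are separable with respect to the class of all finite abelian groups. -/
theorem stmt18 (p : ℕ) (hp : p.Prime) :
    (∀ (G : Type) [CommGroup G] [Fintype G] [DecidableEq G],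
      Fintype.card G = 9 → (∀ g : G, g ^ 3 = 1) →
      ∀ A : SRing G, A.SeparableA) ∧
    (∀ (G : Type) [CommGroup G] [Fintype G] [DecidableEq G],
      IsCyclic G → Fintype.card G = p →
      ∀ A : SRing G, A.SeparableA) ∧
    (∀ (G : Type) [CommGroup G] [Fintype G] [DecidableEq G],
      IsCyclic G → Fintype.card G = 3 * p →
      ∀ A : SRing G, A.SeparableA) := by
  have hcard (G : Type) [Fintype G] : Nat.card (Additive G) = Fintype.card G :=
    (Nat.card_congr Additive.toMul).trans Nat.card_eq_fintype_card
  refine ⟨fun G _ _ _ hG _ A => ?_, fun G _ _ _ _ hG A => ?_, fun G _ _ _ _ hG A => ?_⟩ <;>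
    refine A.separableA_of_realizable fun H _ _ c c' M => ?_
  · exact M.realizable_of_card_nine ((hcard G).trans hG)
  · exact M.realizable_of_card_prime hp ((hcard G).trans hG)
  · by_cases h3 : 3 = p
    · exact M.realizable_of_card_nine ((hcard G).trans (hG.trans (by rw [← h3])))
    · exact M.realizable_of_card_mul_prime Nat.prime_three hp h3 ((hcard G).trans hG)
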